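/- arXiv:math/0409205 — 4 statements merged into one kernel-verified Lean document; each statement's English description precedes it below -/
import Mathlib

section
/- The braid group B_n is torsion-free for every n ≥ 1: if g ∈ B_n and g^k = 1 for some integer k ≥ 1, then g = 1. -/
/-- The set of relators for Artin's classical presentation of the braid group `Bₙ`:
generators `σ₁, …, σ_{n-1}` (indexed by `Fin (n-1)`), with relations
`σᵢ σₖ = σₖ σᵢ` when `|i - k| ≥ 2` and `σᵢ σ_{i+1} σᵢ = σ_{i+1} σᵢ σ_{i+1}`. -/
def braidRels (n : ℕ) : Set (FreeGroup (Fin (n - 1))) :=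
  {w | (∃ i k : Fin (n - 1), (i : ℕ) + 2 ≤ (k : ℕ) ∧
          w = FreeGroup.of i * FreeGroup.of k * (FreeGroup.of k * FreeGroup.of i)⁻¹) ∨
       (∃ i k : Fin (n - 1), (i : ℕ) + 1 = (k : ℕ) ∧
          w = FreeGroup.of i * FreeGroup.of k * FreeGroup.of i *
              (FreeGroup.of k * FreeGroup.of i * FreeGroup.of k)⁻¹)}

/-- The braid group `Bₙ`, given by Artin's classical presentation. -/
abbrev BraidGroup (n : ℕ) : Type := PresentedGroup (braidRels n)

/-- A group with a left-invariant semilattice order is torsion-free. -/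
theorem eq_one_of_pow_eq_one_of_semilatticeSup {G : Type*} [Group G] [SemilatticeSup G]
    [MulLeftMono G] {g : G} {k : ℕ} (hk : 0 < k) (h : g ^ k = 1) : g = 1 := by
  have hne : (Finset.range k).Nonempty := Finset.nonempty_range_iff.2 hk.ne'
  set s : G := (Finset.range k).sup' hne fun i => g ^ i with hs
  have key : ∀ i : ℕ, g ^ i ≤ s := fun i => by
    rw [← Nat.mod_add_div i k, pow_add, pow_mul, h, one_pow, mul_one]
    exact Finset.le_sup' (fun i => g ^ i) (Finset.mem_range.2 (Nat.mod_lt _ hk))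
  have hinv : s ≤ g⁻¹ * s := Finset.sup'_le _ _ fun i _ => by
    rw [le_inv_mul_iff_mul_le, ← pow_succ']
    exact key _
  have hle : ∀ j : ℕ, g ^ j * s ≤ s := fun j => by
    induction j with
    | zero => simp
    | succ j ih =>
      rw [pow_succ', mul_assoc]
      exact (mul_le_mul_right ih g).trans (le_inv_mul_iff_mul_le.1 hinv)
  have hge : s ≤ g * s := by
    have := hle (k - 1)
    rw [← mul_le_mul_iff_left g, ← mul_assoc, ← pow_succ', Nat.sub_add_cancel hk, h,
      one_mul] at this
    exact this
  exact mul_eq_right.1 (le_antisymm (le_inv_mul_iff_mul_le.1 hinv) hge)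

/-- If `z` is central, then its powers satisfy the Ore condition. -/
@[reducible]
def oreSetPowersOfCentral {M : Type*} [Monoid M] (z : M) (hz : ∀ m, Commute z m) :
    OreLocalization.OreSet (Submonoid.powers z) where
  ore_right_cancel r₁ r₂ s h := by
    obtain ⟨_, N, rfl⟩ := s
    exact ⟨⟨_, N, rfl⟩, by simpa only [((hz _).pow_left N).eq] using h⟩
  oreNum r _ := r
  oreDenom _ s := s
  ore_eq r s := by
    obtain ⟨_, N, rfl⟩ := s
    exact ((hz r).pow_left N).eq

/-- A group of fractions of a left cancellative monoid with least common right multiples and without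
nontrivial units is torsion-free. -/
theorem eq_one_of_pow_eq_one_of_lcm {M G : Type*} [Monoid M] [Group G] (π : M →* G)
    (hπ : Function.Injective π) (hunit : ∀ a b : M, a * b = 1 → a = 1)
    (hlcm : ∀ a b : M, ∃ l, ∀ y, l ∣ y ↔ a ∣ y ∧ b ∣ y)
    (hfrac : ∀ x y : G, ∃ (w : G) (a b : M), w * x = π a ∧ w * y = π b)
    {g : G} {k : ℕ} (hk : 0 < k) (h : g ^ k = 1) : g = 1 := by
  let : PartialOrder G :=
    { le := fun x y => ∃ m, x * π m = y
      le_refl := fun x => ⟨1, by simp⟩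
      le_trans := by
        rintro x _ _ ⟨m, rfl⟩ ⟨m', rfl⟩
        exact ⟨m * m', by simp [mul_assoc]⟩
      le_antisymm := by
        rintro x _ ⟨m, rfl⟩ ⟨m', h'⟩
        rw [mul_assoc, mul_eq_left, ← map_mul, map_eq_one_iff π hπ] at h'
        simp [hunit _ _ h'] }
  have le_iff : ∀ x y : G, x ≤ y ↔ ∃ m, x * π m = y := fun _ _ => Iff.rfl
  have : MulLeftMono G := ⟨by
    rintro g x _ ⟨m, rfl⟩
    exact ⟨m, by simp [mul_assoc]⟩⟩
  have dvd_iff : ∀ (w : G) (a : M) (t : M), w⁻¹ * π a ≤ w⁻¹ * π t ↔ a ∣ t := fun w a t => by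
    simp only [le_iff, mul_assoc, mul_right_inj, ← map_mul, hπ.eq_iff]
    exact ⟨fun ⟨m, hm⟩ => ⟨m, hm.symm⟩, fun ⟨m, hm⟩ => ⟨m, hm.symm⟩⟩
  have hsup : ∀ x y : G, ∃ s, IsLUB {x, y} s := fun x y => by
    obtain ⟨w, a, b, ha, hb⟩ := hfrac x y
    obtain rfl := eq_inv_mul_of_mul_eq ha
    obtain rfl := eq_inv_mul_of_mul_eq hb
    obtain ⟨l, hl⟩ := hlcm a b
    refine ⟨w⁻¹ * π l, ?_, ?_⟩
    · rintro _ (rfl | rfl)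
      · exact (dvd_iff w a l).2 ((hl l).1 dvd_rfl).1
      · exact (dvd_iff w b l).2 ((hl l).1 dvd_rfl).2
    · intro t ht
      obtain ⟨m, rfl⟩ := ht (Set.mem_insert _ _)
      have hb := ht (Set.mem_insert_of_mem _ rfl)
      rw [mul_assoc, ← map_mul] at hb ⊢
      exact (dvd_iff w l _).2 ((hl _).2 ⟨dvd_mul_right _ _, (dvd_iff w b _).1 hb⟩)
  choose sup hsup using hsup
  let : SemilatticeSup G :=
    { sup := sup
      le_sup_left := fun x y => (hsup x y).1 (Set.mem_insert _ _)
      le_sup_right := fun x y => (hsup x y).1 (Set.mem_insert_of_mem _ rfl)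
      sup_le := fun x y t hx hy => (hsup x y).2 (by rintro _ (rfl | rfl) <;> assumption) }
  exact eq_one_of_pow_eq_one_of_semilatticeSup hk h

namespace ArtinMonoid

variable {α : Type*} (G : SimpleGraph α)

open Classical in
/-- The word `w` such that `i w` is the least common right multiple of the generators `i` and `j`
in the simply laced Artin monoid of `G`. -/
noncomputable def complementWord (i j : α) : FreeMonoid α :=
  if i = j then 1 else if G.Adj i j then .of j * .of i else .of j

/-- The defining relations of the simply laced Artin monoid of a graph: adjacent generators
satisfy the braid relation, all other generators commute. -/
def Rel (u v : FreeMonoid α) : Prop :=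
  ∃ i j, u = .of i * complementWord G i j ∧ v = .of j * complementWord G j i

end ArtinMonoid

/-- The simply laced Artin monoid of a graph. -/
abbrev ArtinMonoid {α : Type*} (G : SimpleGraph α) : Type _ := PresentedMonoid (ArtinMonoid.Rel G)

namespace ArtinMonoid

variable {α : Type*} (G : SimpleGraph α)

/-- The generators of the Artin monoid. -/
def gen (i : α) : ArtinMonoid G := PresentedMonoid.of _ i

/-- The class of `complementWord` in the Artin monoid. -/
noncomputable def complement (i j : α) : ArtinMonoid G := PresentedMonoid.mk _ (complementWord G i j)

variable {G} {i j : α}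

@[simp]
theorem complement_self (i : α) : complement G i i = 1 := by
  simp [complement, complementWord]

theorem complement_of_adj (h : G.Adj i j) : complement G i j = gen G j * gen G i := by
  simp [complement, complementWord, h, h.ne, gen, PresentedMonoid.of]

theorem complement_of_not_adj (hne : i ≠ j) (h : ¬ G.Adj i j) : complement G i j = gen G j := by
  simp [complement, complementWord, h, hne, gen, PresentedMonoid.of]

variable (G) in
theorem gen_mul_complement (i j : α) :
    gen G i * complement G i j = gen G j * complement G j i := by
  simp only [gen, complement, PresentedMonoid.of, ← map_mul]
  exact PresentedMonoid.mk_eq_mk_of_rel ⟨i, j, rfl, rfl⟩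

theorem commute_gen (h : ¬ G.Adj i j) : Commute (gen G i) (gen G j) := by
  by_cases hne : i = j
  · subst hne; rfl
  have := gen_mul_complement G i j
  rwa [complement_of_not_adj hne h, complement_of_not_adj (Ne.symm hne) (mt SimpleGraph.Adj.symm h)] at this

theorem braid_gen (h : G.Adj i j) :
    gen G i * (gen G j * gen G i) = gen G j * (gen G i * gen G j) := by
  have := gen_mul_complement G i j
  rwa [complement_of_adj h, complement_of_adj h.symm] at this

/-- The Artin monoid maps to any monoid in which its relations hold. -/
noncomputable def lift {N : Type*} [Monoid N] (f : α → N)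
    (hb : ∀ i j, G.Adj i j → f i * (f j * f i) = f j * (f i * f j))
    (hc : ∀ i j, ¬ G.Adj i j → f i * f j = f j * f i) : ArtinMonoid G →* N :=
  PresentedMonoid.lift f (by
    rintro _ _ ⟨i, j, rfl, rfl⟩
    by_cases hne : i = j
    · subst hne; rfl
    by_cases h : G.Adj i j
    · simpa [complementWord, hne, Ne.symm hne, h, h.symm] using hb i j h
    · simpa [complementWord, hne, Ne.symm hne, h, mt SimpleGraph.Adj.symm h] using hc i j h)

@[simp]
theorem lift_gen {N : Type*} [Monoid N] (f : α → N)
    (hb : ∀ i j, G.Adj i j → f i * (f j * f i) = f j * (f i * f j))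
    (hc : ∀ i j, ¬ G.Adj i j → f i * f j = f j * f i) (i : α) : lift f hb hc (gen G i) = f i :=
  rfl

/-- The word length of an element of the Artin monoid. -/
noncomputable def length (a : ArtinMonoid G) : ℕ :=
  (lift (G := G) (fun _ => Multiplicative.ofAdd 1) (fun _ _ _ => rfl) (fun _ _ _ => rfl) a).toAdd

@[simp]
theorem length_one : length (1 : ArtinMonoid G) = 0 := by
  simp [length]

@[simp]
theorem length_mul (a b : ArtinMonoid G) : length (a * b) = length a + length b := by
  simp [length]

@[simp]
theorem length_gen (i : α) : length (gen G i) = 1 := by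
  simp [length]

theorem eq_one_or_eq_gen_mul (a : ArtinMonoid G) : a = 1 ∨ ∃ i b, a = gen G i * b := by
  induction a using PresentedMonoid.inductionOn with | _ a
  cases a with
  | one => exact Or.inl rfl
  | of_mul i b => exact Or.inr ⟨i, PresentedMonoid.mk _ b, rfl⟩

@[elab_as_elim]
theorem gen_induction {p : ArtinMonoid G → Prop} (a : ArtinMonoid G) (one : p 1)
    (gen_mul : ∀ i b, p b → p (gen G i * b)) : p a := by
  induction a using PresentedMonoid.inductionOn with | _ a
  induction a using FreeMonoid.inductionOn' with
  | one => exact one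
  | of_mul i b ih => exact gen_mul i _ ih

theorem eq_one_of_length_eq_zero {a : ArtinMonoid G} (h : length a = 0) : a = 1 := by
  obtain rfl | ⟨i, b, rfl⟩ := eq_one_or_eq_gen_mul a
  · rfl
  · simp at h

theorem eq_one_of_mul_eq_one {a b : ArtinMonoid G} (h : a * b = 1) : a = 1 := by
  apply eq_one_of_length_eq_zero
  have := congrArg length h
  simp at this
  exact this.1

/-- Garside's property for a pair of elements. -/
def Compatible (i j : α) (a b : ArtinMonoid G) : Prop :=
  ∃ c, a = complement G i j * c ∧ b = complement G j i * c

theorem Compatible.symm {a b : ArtinMonoid G} (h : Compatible i j a b) : Compatible j i b a :=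
  let ⟨c, ha, hb⟩ := h
  ⟨c, hb, ha⟩

theorem gen_mul_left_comm (h : ¬ G.Adj i j) (x : ArtinMonoid G) :
    gen G i * (gen G j * x) = gen G j * (gen G i * x) := by
  simp only [← mul_assoc, (commute_gen h).eq]

theorem braid_gen_mul (h : G.Adj i j) (x : ArtinMonoid G) :
    gen G i * (gen G j * (gen G i * x)) = gen G j * (gen G i * (gen G j * x)) := by
  have := congrArg (· * x) (braid_gen h)
  simpa only [mul_assoc] using this

/-- Any two generators commuting with `k` satisfy the cube condition with `k`. -/
theorem Compatible.gen_mul_of_not_adj {k : α} {a b : ArtinMonoid G} (ik : ¬ G.Adj i k)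
    (kj : ¬ G.Adj k j) (h : Compatible i j a b) :
    Compatible i j (gen G k * a) (gen G k * b) := by
  obtain ⟨c, rfl, rfl⟩ := h
  have cki : Commute (gen G k) (gen G i) := (commute_gen ik).symm
  have ckj : Commute (gen G k) (gen G j) := commute_gen kj
  have key : Commute (gen G k) (complement G i j) ∧ Commute (gen G k) (complement G j i) := by
    by_cases hne : i = j
    · subst hne; simp
    by_cases h : G.Adj i j
    · rw [complement_of_adj h, complement_of_adj h.symm]
      exact ⟨ckj.mul_right cki, cki.mul_right ckj⟩
    · rw [complement_of_not_adj hne h,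
        complement_of_not_adj (Ne.symm hne) (mt SimpleGraph.Adj.symm h)]
      exact ⟨ckj, cki⟩
  exact ⟨gen G k * c, by rw [← mul_assoc, key.1.eq, mul_assoc],
    by rw [← mul_assoc, key.2.eq, mul_assoc]⟩

/-- Garside's property for all elements of length less than `n`. -/
def CompatibleBelow (G : SimpleGraph α) (n : ℕ) : Prop :=
  ∀ (i j : α) (a b : ArtinMonoid G), length a < n → gen G i * a = gen G j * b →
    Compatible i j a b

theorem CompatibleBelow.mono {m n : ℕ} (h : CompatibleBelow G n) (hmn : m ≤ n) :
    CompatibleBelow G m :=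
  fun i j a b hm => h i j a b (hm.trans_le hmn)

/-- The case of the cube condition in which `i` commutes with `k`, which is adjacent to `j`. -/
theorem CompatibleBelow.cube_of_not_adj_of_adj {n : ℕ} (ih : CompatibleBelow G n)
    {k : α} {c c' : ArtinMonoid G} (hij : i ≠ j) (hik : i ≠ k) (ik : ¬ G.Adj i k) (kj : G.Adj k j)
    (hn : length c < n) (h : gen G i * c = gen G j * (gen G k * c')) :
    Compatible i j (gen G k * c) (gen G k * (gen G j * c')) := by
  have ki : ¬ G.Adj k i := mt SimpleGraph.Adj.symm ik
  have hl := congrArg length h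
  simp only [length_mul, length_gen] at hl
  obtain ⟨e, rfl, h₁⟩ := ih _ _ _ _ hn h
  by_cases ij : G.Adj i j
  · rw [complement_of_adj ij] at hl hn ⊢
    rw [complement_of_adj ij.symm, mul_assoc] at h₁
    simp only [length_mul, length_gen] at hl hn
    obtain ⟨f, rfl, h₂⟩ := ih _ _ _ _ (by omega) h₁
    rw [complement_of_not_adj hik.symm ki] at hl ⊢
    rw [complement_of_not_adj hik ik] at h₂
    simp only [length_mul, length_gen] at hl
    obtain ⟨g, rfl, rfl⟩ := ih _ _ _ _ (by omega) h₂
    rw [complement_of_adj kj, complement_of_adj kj.symm]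
    refine ⟨gen G k * (gen G j * (gen G i * g)), ?_, ?_⟩
    · rw [complement_of_adj ij]
      simp only [mul_assoc]
      rw [gen_mul_left_comm ik, braid_gen_mul kj, ← braid_gen_mul ij, gen_mul_left_comm ki]
    · rw [complement_of_adj ij.symm]
      simp only [mul_assoc]
      rw [braid_gen_mul ij.symm, gen_mul_left_comm ki, gen_mul_left_comm ik g, braid_gen_mul kj]
  · have ji : ¬ G.Adj j i := mt SimpleGraph.Adj.symm ij
    rw [complement_of_not_adj hij ij] at hl hn ⊢
    rw [complement_of_not_adj hij.symm ji] at h₁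
    simp only [length_mul, length_gen] at hl hn
    obtain ⟨f, rfl, rfl⟩ := ih _ _ _ _ (by omega) h₁
    rw [complement_of_not_adj hik ik, complement_of_not_adj hik.symm ki]
    refine ⟨gen G k * (gen G j * f), ?_, ?_⟩
    · rw [complement_of_not_adj hij ij, braid_gen_mul kj]
    · rw [complement_of_not_adj hij.symm ji, gen_mul_left_comm ji, gen_mul_left_comm ki]

/-- The case of the cube condition in which `k` is adjacent to both `i` and `j`. -/
theorem CompatibleBelow.cube_of_adj_of_adj {n : ℕ} (ih : CompatibleBelow G n)
    {k : α} {c c' : ArtinMonoid G} (hij : i ≠ j) (ij : ¬ G.Adj i j) (ik : G.Adj i k)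
    (kj : G.Adj k j) (hn : length (gen G k * c) < n)
    (h : gen G i * (gen G k * c) = gen G j * (gen G k * c')) :
    Compatible i j (gen G k * (gen G i * c)) (gen G k * (gen G j * c')) := by
  have ji : ¬ G.Adj j i := mt SimpleGraph.Adj.symm ij
  obtain ⟨e, h₁, h₂⟩ := ih _ _ _ _ hn h
  have hl := congrArg length h
  have hl₁ := congrArg length h₁
  rw [complement_of_not_adj hij ij] at h₁ hl₁
  rw [complement_of_not_adj hij.symm ji] at h₂
  simp only [length_mul, length_gen] at hn hl hl₁
  obtain ⟨f, rfl, rfl⟩ := ih _ _ _ _ (by omega) h₁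
  obtain ⟨g, rfl, hfg⟩ := ih _ _ _ _ (by omega) h₂
  rw [complement_of_adj kj, complement_of_adj ik] at *
  rw [complement_of_adj kj.symm, complement_of_adj ik.symm] at *
  simp only [mul_assoc, length_mul, length_gen] at *
  obtain ⟨f', hf, hf'⟩ := ih _ _ _ _ (by simp; omega) hfg
  simp only [complement_self, one_mul] at hf hf'
  obtain ⟨g, rfl, rfl⟩ := ih _ _ _ _ (by omega) (hf.trans hf'.symm)
  rw [complement_of_not_adj hij ij, complement_of_not_adj hij.symm ji]
  refine ⟨gen G k * (gen G j * (gen G i * (gen G k * g))), ?_, ?_⟩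
  · rw [complement_of_not_adj hij ij]
    rw [gen_mul_left_comm ij, braid_gen_mul ik, braid_gen_mul kj]
  · rw [complement_of_not_adj hij.symm ji]
    rw [gen_mul_left_comm ji, braid_gen_mul kj.symm, braid_gen_mul ik.symm, gen_mul_left_comm ij]

/-- The relation defining Garside's property is transitive. -/
theorem CompatibleBelow.trans {n : ℕ} (ih : CompatibleBelow G n)
    (hG : ∀ i j k, G.Adj i k → G.Adj k j → ¬ G.Adj i j) {k : α} {a d b : ArtinMonoid G}
    (hn : length d = n) (h₁ : Compatible i k a d) (h₂ : Compatible k j d b) :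
    Compatible i j a b := by
  by_cases hik : i = k
  · subst hik
    obtain ⟨c, rfl, rfl⟩ := h₁
    exact h₂
  by_cases hkj : k = j
  · subst hkj
    obtain ⟨c, rfl, rfl⟩ := h₂
    exact h₁
  obtain ⟨c, rfl, hc⟩ := h₁
  obtain ⟨c', rfl, rfl⟩ := h₂
  have hki := Ne.symm hik
  have hjk := Ne.symm hkj
  have hl := congrArg length hc
  by_cases ik : G.Adj i k <;> by_cases kj : G.Adj k j
  · rw [complement_of_adj ik, complement_of_adj kj.symm]
    rw [complement_of_adj ik.symm, complement_of_adj kj] at *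
    simp only [mul_assoc, length_mul, length_gen] at *
    by_cases hij : i = j
    · subst hij
      obtain ⟨e, h₁, h₂⟩ := ih _ _ _ _ (by simp; omega) hc
      simp only [complement_self, one_mul] at h₁ h₂
      obtain ⟨e, h₃, h₄⟩ := ih _ _ _ _ (by omega) (h₁.trans h₂.symm)
      simp only [complement_self, one_mul] at h₃ h₄
      exact ⟨gen G k * (gen G i * e), by simp [h₄], by simp [h₃]⟩
    · exact ih.cube_of_adj_of_adj hij (hG _ _ _ ik kj) ik kj (by simp; omega) hc.symm
  · have jk : ¬ G.Adj j k := mt SimpleGraph.Adj.symm kj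
    have hij : i ≠ j := by rintro rfl; exact jk ik
    rw [complement_of_adj ik, complement_of_not_adj hjk jk]
    rw [complement_of_adj ik.symm, complement_of_not_adj hkj kj] at *
    simp only [mul_assoc, length_mul, length_gen] at *
    exact (ih.cube_of_not_adj_of_adj hij.symm hjk jk ik.symm (by omega) hc).symm
  · have ki : ¬ G.Adj k i := mt SimpleGraph.Adj.symm ik
    have hij : i ≠ j := by rintro rfl; exact ki kj
    rw [complement_of_adj kj.symm, complement_of_not_adj hik ik]
    rw [complement_of_adj kj, complement_of_not_adj hki ki] at *
    simp only [mul_assoc, length_mul, length_gen] at *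
    exact ih.cube_of_not_adj_of_adj hij hik ik kj (by omega) hc.symm
  · have ki : ¬ G.Adj k i := mt SimpleGraph.Adj.symm ik
    have jk : ¬ G.Adj j k := mt SimpleGraph.Adj.symm kj
    rw [complement_of_not_adj hik ik, complement_of_not_adj hjk jk]
    rw [complement_of_not_adj hki ki, complement_of_not_adj hkj kj] at *
    simp only [length_mul, length_gen] at *
    exact (ih _ _ _ _ (by omega) hc.symm).gen_mul_of_not_adj ik kj

/-- Equivalent words satisfy Garside's property. -/
theorem CompatibleBelow.of_conGen {n : ℕ} (ih : CompatibleBelow G n)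
    (hG : ∀ i j k, G.Adj i k → G.Adj k j → ¬ G.Adj i j) {u v : FreeMonoid α}
    (h : conGen (Rel G) u v) (hn : length (PresentedMonoid.mk (Rel G) u) ≤ n + 1) {i j : α}
    {a b : FreeMonoid α} (hu : u = .of i * a) (hv : v = .of j * b) :
    Compatible i j (PresentedMonoid.mk (Rel G) a) (PresentedMonoid.mk (Rel G) b) := by
  have length_of_mul : ∀ k (d : FreeMonoid α), length (PresentedMonoid.mk (Rel G) (.of k * d)) =
      length (PresentedMonoid.mk (Rel G) d) + 1 := fun k d =>
    (length_mul (gen G k) (PresentedMonoid.mk (Rel G) d)).trans (by rw [length_gen, add_comm])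
  have compatible_refl : ∀ {u} {i j : α} {a b : FreeMonoid α}, u = .of i * a → u = .of j * b →
      Compatible i j (PresentedMonoid.mk (Rel G) a) (PresentedMonoid.mk (Rel G) b) := by
    rintro _ i j a b rfl h
    obtain ⟨rfl, rfl⟩ := List.cons.inj h
    exact ⟨PresentedMonoid.mk (Rel G) a, by simp, by rw [complement_self, one_mul]; rfl⟩
  change ConGen.Rel (Rel G) u v at h
  induction h generalizing i j a b with
  | of u v h =>
    obtain ⟨k, l, rfl, rfl⟩ := h
    obtain ⟨rfl, rfl⟩ := List.cons.inj hu
    obtain ⟨rfl, rfl⟩ := List.cons.inj hv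
    exact ⟨1, (mul_one _).symm, (mul_one _).symm⟩
  | refl u => exact compatible_refl hu hv
  | @symm u v h ih' =>
    exact (ih' (by rwa [PresentedMonoid.mk_eq_mk_iff.2 h]) hv hu).symm
  | @trans u y v h h' ih₁ ih₂ =>
    have hl := congrArg length (PresentedMonoid.mk_eq_mk_iff.2 h)
    rw [hu, length_of_mul] at hl
    cases y with
    | one => simp at hl
    | of_mul k d =>
      rw [hu, length_of_mul] at hn
      have hd := length_of_mul k d
      have hab := congrArg length (PresentedMonoid.mk_eq_mk_iff.2 h')
      rw [hv, length_of_mul] at hab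
      have h₁ := ih₁ (by rw [hu, length_of_mul]; omega) hu rfl
      have h₂ := ih₂ (by omega) rfl hv
      exact (ih.mono (by omega)).trans hG rfl h₁ h₂
  | @mul w x y z h h' ih₁ ih₂ =>
    have hl := congrArg length (PresentedMonoid.mk_eq_mk_iff.2 h)
    rw [map_mul, length_mul] at hn
    cases w with
    | one =>
      cases x with
      | one => exact ih₂ (by omega) (by simpa using hu) (by simpa using hv)
      | of_mul l x => rw [length_of_mul] at hl; simp at hl
    | of_mul k w =>
      cases x with
      | one => rw [length_of_mul] at hl; simp at hl
      | of_mul l x =>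
        obtain ⟨rfl, rfl⟩ := List.cons.inj hu
        obtain ⟨rfl, rfl⟩ := List.cons.inj hv
        obtain ⟨c, hw, hx⟩ := ih₁ (by omega) rfl rfl
        refine ⟨c * PresentedMonoid.mk (Rel G) y, ?_, ?_⟩
        · rw [← mul_assoc, ← hw, ← map_mul]
          rfl
        · rw [PresentedMonoid.mk_eq_mk_iff.2 h', ← mul_assoc, ← hx, ← map_mul]
          rfl

theorem compatibleBelow (hG : ∀ i j k, G.Adj i k → G.Adj k j → ¬ G.Adj i j) (n : ℕ) :
    CompatibleBelow G n := by
  induction n with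
  | zero => intro i j a b h; omega
  | succ n ih =>
    intro i j a b hn h
    induction a using PresentedMonoid.inductionOn with | _ a
    induction b using PresentedMonoid.inductionOn with | _ b
    refine ih.of_conGen hG (PresentedMonoid.mk_eq_mk_iff.1 h) ?_ rfl rfl
    have := length_mul (gen G i) (PresentedMonoid.mk (Rel G) a)
    rw [length_gen] at this
    exact this.trans_le (by omega)

/-- **Garside's theorem** on equal products starting with given generators. -/
theorem compatible_of_gen_mul_eq (hG : ∀ i j k, G.Adj i k → G.Adj k j → ¬ G.Adj i j)
    {a b : ArtinMonoid G} (h : gen G i * a = gen G j * b) : Compatible i j a b :=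
  compatibleBelow hG _ _ _ _ _ (Nat.lt_succ_self _) h

theorem mul_left_cancel (hG : ∀ i j k, G.Adj i k → G.Adj k j → ¬ G.Adj i j)
    {a b c : ArtinMonoid G} (h : a * b = a * c) : b = c := by
  induction a using gen_induction with
  | one => simpa using h
  | gen_mul i a ih =>
    simp only [mul_assoc] at h
    obtain ⟨e, h₁, h₂⟩ := compatible_of_gen_mul_eq hG h
    exact ih (by simp [h₁, h₂])

theorem mul_dvd_mul_iff (hG : ∀ i j k, G.Adj i k → G.Adj k j → ¬ G.Adj i j)
    {a b c : ArtinMonoid G} : a * b ∣ a * c ↔ b ∣ c := by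
  refine ⟨?_, mul_dvd_mul_left a⟩
  rintro ⟨d, h⟩
  rw [mul_assoc] at h
  exact ⟨d, mul_left_cancel hG h⟩

/-- `l` is the least common right multiple of `a` and `b`. -/
def IsLcm (a b l : ArtinMonoid G) : Prop :=
  ∀ y, l ∣ y ↔ a ∣ y ∧ b ∣ y

theorem isLcm_gen (hG : ∀ i j k, G.Adj i k → G.Adj k j → ¬ G.Adj i j) (i j : α) :
    IsLcm (gen G i) (gen G j) (gen G i * complement G i j) := by
  intro y
  constructor
  · refine fun h => ⟨(dvd_mul_right _ _).trans h, ?_⟩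
    rw [gen_mul_complement] at h
    exact (dvd_mul_right _ _).trans h
  · rintro ⟨⟨a, rfl⟩, b, h⟩
    obtain ⟨c, rfl, rfl⟩ := compatible_of_gen_mul_eq hG h
    rw [mul_dvd_mul_iff hG]
    exact dvd_mul_right _ _

theorem IsLcm.mul_left (hG : ∀ i j k, G.Adj i k → G.Adj k j → ¬ G.Adj i j)
    {a b l : ArtinMonoid G} (h : IsLcm a b l) (c : ArtinMonoid G) :
    IsLcm (c * a) (c * b) (c * l) := by
  intro y
  constructor
  · intro hy
    exact ⟨(mul_dvd_mul_left c ((h l).1 dvd_rfl).1).trans hy,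
      (mul_dvd_mul_left c ((h l).1 dvd_rfl).2).trans hy⟩
  · rintro ⟨ha, hb⟩
    obtain ⟨y, rfl⟩ := (dvd_mul_right c a).trans ha
    rw [mul_dvd_mul_iff hG] at *
    exact (h y).2 ⟨ha, hb⟩

/-- Elements with a common right multiple have a least one. -/
theorem exists_isLcm (hG : ∀ i j k, G.Adj i k → G.Adj k j → ¬ G.Adj i j) (n : ℕ)
    {a b x : ArtinMonoid G} (hn : length x ≤ n) (ha : a ∣ x) (hb : b ∣ x) :
    ∃ l, IsLcm a b l := by
  induction n generalizing a b x with
  | zero =>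
    obtain rfl := eq_one_of_length_eq_zero (Nat.le_zero.1 hn)
    obtain ⟨_, h⟩ := ha
    obtain rfl := eq_one_of_mul_eq_one h.symm
    exact ⟨b, fun y => by simp⟩
  | succ n ih =>
    obtain rfl | ⟨i, a, rfl⟩ := eq_one_or_eq_gen_mul a
    · exact ⟨b, fun y => by simp⟩
    obtain rfl | ⟨j, b, rfl⟩ := eq_one_or_eq_gen_mul b
    · exact ⟨gen G i * a, fun y => by simp⟩
    obtain ⟨l, hl⟩ : ∃ l, IsLcm (gen G i * a) (gen G j) l := by
      have hx := (isLcm_gen hG i j x).2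
        ⟨(dvd_mul_right _ _).trans ha, (dvd_mul_right _ _).trans hb⟩
      obtain ⟨x, rfl⟩ := (dvd_mul_right _ _).trans ha
      rw [mul_dvd_mul_iff hG] at ha hx
      obtain ⟨p, hp⟩ := ih (by simp at hn; omega) ha hx
      refine ⟨gen G i * p, fun y => ?_⟩
      rw [hp.mul_left hG (gen G i) y, isLcm_gen hG i j y]
      exact ⟨fun h => ⟨h.1, h.2.2⟩, fun h => ⟨h.1, (dvd_mul_right _ _).trans h.1, h.2⟩⟩
    have hx := (hl x).2 ⟨ha, (dvd_mul_right _ _).trans hb⟩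
    obtain ⟨r, rfl⟩ := ((hl l).1 dvd_rfl).2
    obtain ⟨x, rfl⟩ := (dvd_mul_right _ _).trans hb
    rw [mul_dvd_mul_iff hG] at hb hx
    obtain ⟨t, ht⟩ := ih (by simp at hn; omega) hx hb
    refine ⟨gen G j * t, fun y => ?_⟩
    rw [ht.mul_left hG (gen G j) y, hl y]
    exact ⟨fun h => ⟨h.1.1, h.2⟩, fun h => ⟨⟨h.1, (dvd_mul_right _ _).trans h.2⟩, h.2⟩⟩

universe u

section Central

variable {z : ArtinMonoid G} (hz : ∀ a, Commute z a) (hdvd : ∀ i, gen G i ∣ z)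
include hz hdvd

theorem dvd_pow_length (a : ArtinMonoid G) : a ∣ z ^ length a := by
  induction a using gen_induction with
  | one => simp
  | gen_mul i a ih =>
    obtain ⟨b, hb⟩ := ih
    obtain ⟨r, hr⟩ := hdvd i
    refine ⟨b * r, ?_⟩
    rw [length_mul, length_gen, pow_add, pow_one, mul_assoc, ← mul_assoc a, ← hb,
      ((hz r).pow_left _).eq, ← mul_assoc, ← hr]

theorem exists_isLcm_of_central (hG : ∀ i j k, G.Adj i k → G.Adj k j → ¬ G.Adj i j)
    (a b : ArtinMonoid G) : ∃ l, IsLcm a b l :=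
  exists_isLcm hG _ le_rfl
    ((dvd_pow_length hz hdvd a).trans (pow_dvd_pow z (Nat.le_add_right _ (length b))))
    ((dvd_pow_length hz hdvd b).trans (pow_dvd_pow z (Nat.le_add_left _ (length a))))

omit hdvd in
theorem commute_of_gen_mul_eq (hG : ∀ i j k, G.Adj i k → G.Adj k j → ¬ G.Adj i j)
    {r : ArtinMonoid G} (h : z = gen G i * r) : Commute (gen G i) r :=
  mul_left_cancel hG (a := gen G i) <| by
    rw [← mul_assoc (gen G i) r, ← h, (hz _).eq]

end Central

/-- A group with the universal property of the group of the Artin monoid of a triangle-free graph is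
torsion-free, provided that the monoid has a central element which all generators divide. -/
theorem eq_one_of_pow_eq_one {α : Type u} {G : SimpleGraph α}
    (hG : ∀ i j k, G.Adj i k → G.Adj k j → ¬ G.Adj i j) {z : ArtinMonoid G}
    (hz : ∀ a, Commute z a) (hdvd : ∀ i, gen G i ∣ z)
    {H : Type*} [Group H] (π : ArtinMonoid G →* H)
    (hclosure : Subgroup.closure (Set.range fun i => π (gen G i)) = ⊤)
    (huniv : ∀ {N : Type u} [Group N] (ψ : ArtinMonoid G →* N),
      ∃ φ : H →* N, ∀ i, φ (π (gen G i)) = ψ (gen G i))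
    {g : H} {k : ℕ} (hk : 0 < k) (h : g ^ k = 1) : g = 1 := by
  let := oreSetPowersOfCentral z hz
  have hπ : Function.Injective π := by
    let S := Submonoid.powers z
    let ν : ArtinMonoid G →* OreLocalization S (ArtinMonoid G) := OreLocalization.numeratorHom
    have hν : ∀ i, IsUnit (ν (gen G i)) := fun i => by
      obtain ⟨r, hr⟩ := hdvd i
      have hu : IsUnit (ν z) := OreLocalization.numerator_isUnit (⟨z, Submonoid.mem_powers z⟩ : S)
      rw [hr, map_mul] at hu
      exact (((commute_of_gen_mul_eq hz hG hr).map ν).isUnit_mul_iff.1 hu).1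
    have hν' : ∀ a, IsUnit (ν a) := fun a => by
      induction a using gen_induction with
      | one => simp
      | gen_mul i a ih => rw [map_mul]; exact (hν i).mul ih
    obtain ⟨φ, hφ⟩ := huniv (IsUnit.liftRight ν hν')
    have hφν : ∀ a, (φ (π a) : OreLocalization S (ArtinMonoid G)) = ν a := fun a => by
      induction a using gen_induction with
      | one => simp
      | gen_mul i a ih => rw [map_mul, map_mul, map_mul, Units.val_mul, hφ, ih]; rfl
    intro a b hab
    have hab : ν a = ν b := by rw [← hφν, ← hφν, hab]
    obtain ⟨u, v, h₁, h₂⟩ := OreLocalization.oreDiv_eq_iff.1 hab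
    simp only [OneMemClass.coe_one, mul_one] at h₂
    rw [← h₂, Submonoid.smul_def, smul_eq_mul, smul_eq_mul] at h₁
    exact (mul_left_cancel hG h₁).symm
  have hzπ : ∀ x, Commute (π z) x := fun x => by
    have hx : x ∈ Subgroup.closure (Set.range fun i => π (gen G i)) := hclosure ▸ Subgroup.mem_top x
    induction hx using Subgroup.closure_induction with
    | mem x hx => obtain ⟨i, rfl⟩ := hx; exact (hz _).map π
    | one => exact Commute.one_right _
    | mul x y _ _ hx hy => exact hx.mul_right hy
    | inv x _ hx => exact hx.inv_right
  have hfrac : ∀ x, ∃ (N : ℕ) (a : ArtinMonoid G), π z ^ N * x = π a := fun x => by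
    have hx : x ∈ Subgroup.closure (Set.range fun i => π (gen G i)) := hclosure ▸ Subgroup.mem_top x
    induction hx using Subgroup.closure_induction with
    | mem x hx => obtain ⟨i, rfl⟩ := hx; exact ⟨0, gen G i, by simp⟩
    | one => exact ⟨0, 1, by simp⟩
    | mul x y _ _ hx hy =>
      obtain ⟨N, a, ha⟩ := hx
      obtain ⟨N', b, hb⟩ := hy
      refine ⟨N + N', a * b, ?_⟩
      rw [map_mul, ← ha, ← hb, pow_add, mul_assoc, mul_assoc, ← mul_assoc _ x,
        ((hzπ x).pow_left N').eq, mul_assoc]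
    | inv x _ hx =>
      obtain ⟨N, a, ha⟩ := hx
      obtain ⟨b, hb⟩ := dvd_pow_length hz hdvd a
      refine ⟨length a, b * z ^ N, ?_⟩
      rw [((hzπ _).pow_left _).eq, inv_mul_eq_iff_eq_mul, ((hz _).pow_left N).symm.eq, map_mul,
        ← mul_assoc, map_pow π z N, ← ((hzπ x).pow_left N).eq, ha, ← map_mul, ← hb, map_pow]
  refine eq_one_of_pow_eq_one_of_lcm π hπ (fun _ _ => eq_one_of_mul_eq_one)
    (exists_isLcm_of_central hz hdvd hG) (fun x y => ?_) hk h
  obtain ⟨N, a, ha⟩ := hfrac x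
  obtain ⟨N', b, hb⟩ := hfrac y
  refine ⟨π z ^ (N + N'), z ^ N' * a, z ^ N * b, ?_, ?_⟩
  · rw [map_mul, ← ha, map_pow, ← mul_assoc, ← pow_add, add_comm]
  · rw [map_mul, ← hb, map_pow, ← mul_assoc, ← pow_add]

end ArtinMonoid

section FullTwist

variable {M : Type*} [Monoid M] {s : ℕ → M} {m : ℕ}
  (hc : ∀ i j, i + 2 ≤ j → j < m → s i * s j = s j * s i)
  (hb : ∀ i, i + 1 < m → s i * (s (i + 1) * s i) = s (i + 1) * (s i * s (i + 1)))

/-- The product `s 0 * s 1 * ⋯ * s (k - 1)`. -/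
def ascendingProd {M : Type*} [Monoid M] (s : ℕ → M) (k : ℕ) : M := ((List.range k).map s).prod

theorem ascendingProd_succ (s : ℕ → M) (k : ℕ) :
    ascendingProd s (k + 1) = ascendingProd s k * s k :=
  List.prod_range_succ s k

theorem ascendingProd_succ' (s : ℕ → M) (k : ℕ) :
    ascendingProd s (k + 1) = s 0 * ascendingProd (fun i => s (i + 1)) k :=
  List.prod_range_succ' s k

include hc in
theorem commute_ascendingProd {j k : ℕ} (hjk : k + 1 ≤ j) (hj : j < m) :
    Commute (ascendingProd s k) (s j) := by
  induction k with
  | zero => exact Commute.one_left _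
  | succ k ih =>
    rw [ascendingProd_succ]
    exact (ih (by omega)).mul_left (hc k j (by omega) hj)

include hc hb

theorem ascendingProd_mul {i k : ℕ} (hik : i + 1 < k) (hk : k ≤ m) :
    ascendingProd s k * s i = s (i + 1) * ascendingProd s k := by
  induction k with
  | zero => omega
  | succ k ih =>
    obtain hik | rfl : i + 1 < k ∨ i + 1 = k := by omega
    · rw [ascendingProd_succ, mul_assoc, ← hc i k (by omega) (by omega), ← mul_assoc,
        ih hik (by omega), mul_assoc]
    · rw [ascendingProd_succ, ascendingProd_succ, mul_assoc, mul_assoc, hb i (by omega),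
        ← mul_assoc, (commute_ascendingProd hc le_rfl (by omega)).eq, mul_assoc, mul_assoc]

theorem ascendingProd_mul_ascendingProd {k : ℕ} (hk : k + 1 ≤ m) :
    ascendingProd s m * ascendingProd s k =
      ascendingProd (fun i => s (i + 1)) k * ascendingProd s m := by
  induction k with
  | zero => simp [ascendingProd]
  | succ k ih =>
    rw [ascendingProd_succ, ascendingProd_succ, ← mul_assoc, ih (by omega), mul_assoc,
      ascendingProd_mul hc hb (by omega) le_rfl, mul_assoc]

theorem ascendingProd_sq_mul {k : ℕ} (hk : k + 1 = m) :
    ascendingProd s m ^ 2 * s k = s 0 * ascendingProd s m ^ 2 := by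
  have h := ascendingProd_mul_ascendingProd hc hb hk.le
  have h₁ : ascendingProd s m = ascendingProd s k * s k := by rw [← hk, ascendingProd_succ]
  have h₂ : ascendingProd s m = s 0 * ascendingProd (fun i => s (i + 1)) k := by
    rw [← hk, ascendingProd_succ']
  calc ascendingProd s m ^ 2 * s k
      = s 0 * (ascendingProd (fun i => s (i + 1)) k * ascendingProd s m) * s k := by
        rw [sq, ← mul_assoc (s 0), ← h₂]
    _ = s 0 * ascendingProd s m ^ 2 := by
        rw [← h, mul_assoc, mul_assoc, ← h₁, sq]

theorem ascendingProd_pow_mul {i a : ℕ} (h : i + a < m) :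
    ascendingProd s m ^ a * s i = s (i + a) * ascendingProd s m ^ a := by
  induction a with
  | zero => simp
  | succ a ih =>
    rw [pow_succ', mul_assoc, ih (by omega), ← mul_assoc,
      ascendingProd_mul hc hb (by omega) le_rfl, mul_assoc, add_assoc]

/-- The full twist `(s 0 * ⋯ * s (m - 1)) ^ (m + 1)` commutes with the generators. -/
theorem commute_fullTwist {i : ℕ} (hi : i < m) :
    Commute (ascendingProd s m ^ (m + 1)) (s i) := by
  obtain ⟨k, rfl⟩ := Nat.exists_eq_add_of_lt hi
  have h₁ := ascendingProd_pow_mul hc hb (i := i) (a := k) (by omega)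
  have h₂ := ascendingProd_sq_mul hc hb (k := i + k) rfl
  have h₃ := ascendingProd_pow_mul hc hb (i := 0) (a := i) (by omega)
  rw [zero_add] at h₃
  rw [show i + k + 1 + 1 = i + (2 + k) by omega, pow_add, pow_add]
  rw [Commute, SemiconjBy, mul_assoc, mul_assoc, h₁, ← mul_assoc (_ ^ 2), h₂, mul_assoc,
    ← mul_assoc, h₃, mul_assoc]

/-- The generators divide the full twist. -/
theorem dvd_fullTwist {i : ℕ} (hi : i < m) : s i ∣ ascendingProd s m ^ (m + 1) := by
  have h := ascendingProd_pow_mul hc hb (i := 0) (a := i) (by omega)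
  have h₀ : s 0 ∣ ascendingProd s m := by
    obtain ⟨k, rfl⟩ := Nat.exists_eq_add_of_lt (Nat.zero_lt_of_lt hi)
    rw [ascendingProd_succ']
    exact dvd_mul_right _ _
  rw [zero_add] at h
  obtain ⟨r, hr⟩ := h₀
  refine Dvd.dvd.trans ⟨ascendingProd s m ^ i * r, ?_⟩ (pow_dvd_pow _ (by omega : i + 1 ≤ m + 1))
  rw [← mul_assoc, ← h, mul_assoc, ← hr, pow_succ]

end FullTwist

/-- The Artin monoid of a path has a central element which all generators divide. -/
theorem ArtinMonoid.exists_central_pathGraph (m : ℕ) :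
    ∃ z : ArtinMonoid (SimpleGraph.pathGraph m),
      (∀ a, Commute z a) ∧ ∀ i, gen (SimpleGraph.pathGraph m) i ∣ z := by
  let s : ℕ → ArtinMonoid (SimpleGraph.pathGraph m) := fun i =>
    if h : i < m then gen _ ⟨i, h⟩ else 1
  have hs : ∀ i (h : i < m), s i = gen _ ⟨i, h⟩ := fun i h => dif_pos h
  have hc : ∀ i j, i + 2 ≤ j → j < m → s i * s j = s j * s i := fun i j hij hj => by
    rw [hs i (by omega), hs j hj]
    exact commute_gen (by rw [SimpleGraph.pathGraph_adj]; simp; omega)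
  have hb : ∀ i, i + 1 < m → s i * (s (i + 1) * s i) = s (i + 1) * (s i * s (i + 1)) :=
    fun i hi => by
      rw [hs i (by omega), hs (i + 1) hi]
      exact braid_gen (by rw [SimpleGraph.pathGraph_adj]; simp)
  refine ⟨ascendingProd s m ^ (m + 1), fun a => ?_, fun i => ?_⟩
  · induction a using gen_induction with
    | one => exact Commute.one_right _
    | gen_mul i a ih =>
      refine Commute.mul_right ?_ ih
      rw [← hs i i.2]
      exact commute_fullTwist hc hb i.2
  · rw [← hs i i.2]
    exact dvd_fullTwist hc hb i.2

/-- The map from the braid monoid to the braid group. -/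
noncomputable def braidMonoidHom (n : ℕ) :
    ArtinMonoid (SimpleGraph.pathGraph (n - 1)) →* BraidGroup n :=
  have hb : ∀ i j : Fin (n - 1), (i : ℕ) + 1 = j →
      (PresentedGroup.of i * (PresentedGroup.of j * PresentedGroup.of i) : BraidGroup n) =
        PresentedGroup.of j * (PresentedGroup.of i * PresentedGroup.of j) := fun i j h => by
    rw [← mul_assoc, ← mul_assoc]
    exact PresentedGroup.mk_eq_mk_of_mul_inv_mem (Or.inr ⟨i, j, h, rfl⟩)
  have hc : ∀ i j : Fin (n - 1), (i : ℕ) + 2 ≤ j →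
      (PresentedGroup.of i * PresentedGroup.of j : BraidGroup n) =
        PresentedGroup.of j * PresentedGroup.of i := fun i j h =>
    PresentedGroup.mk_eq_mk_of_mul_inv_mem (Or.inl ⟨i, j, h, rfl⟩)
  ArtinMonoid.lift PresentedGroup.of
    (fun i j h => by
      obtain h | h := SimpleGraph.pathGraph_adj.1 h
      · exact hb i j h
      · exact (hb j i h).symm)
    (fun i j h => by
      rw [SimpleGraph.pathGraph_adj] at h
      obtain h | h | h : (i : ℕ) + 2 ≤ j ∨ (j : ℕ) + 2 ≤ i ∨ (i : ℕ) = j := by omega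
      · exact hc i j h
      · exact (hc j i h).symm
      · rw [Fin.ext h])

/-- The braid group `Bₙ` is torsion-free: if `g ^ k = 1` for some integer `k ≥ 1`,
then `g = 1`. -/
theorem braidGroup_torsionFree (n : ℕ) (hn : 1 ≤ n) (g : BraidGroup n) (k : ℤ)
    (hk : 1 ≤ k) (h : g ^ k = 1) : g = 1 := by
  lift k to ℕ using by omega
  obtain ⟨z, hz, hdvd⟩ := ArtinMonoid.exists_central_pathGraph (n - 1)
  refine ArtinMonoid.eq_one_of_pow_eq_one ?_ hz hdvd (braidMonoidHom n)
    (PresentedGroup.closure_range_of _) (fun {N} _ ψ => ?_) (by omega : 0 < k)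
    (by exact_mod_cast h)
  · simp only [SimpleGraph.pathGraph_adj]
    omega
  · refine ⟨PresentedGroup.toGroup (f := fun i => ψ (ArtinMonoid.gen _ i)) ?_,
      fun i => PresentedGroup.toGroup.of _⟩
    rintro _ (⟨i, j, hij, rfl⟩ | ⟨i, j, hij, rfl⟩)
    · simp only [map_mul, map_inv, FreeGroup.lift_apply_of, mul_inv_eq_one]
      rw [← map_mul, ← map_mul]
      exact congrArg ψ (ArtinMonoid.commute_gen (by rw [SimpleGraph.pathGraph_adj]; omega))
    · simp only [map_mul, map_inv, FreeGroup.lift_apply_of, mul_inv_eq_one]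
      simp only [mul_assoc, ← map_mul]
      exact congrArg ψ (ArtinMonoid.braid_gen (i := i) (j := j) (by rw [SimpleGraph.pathGraph_adj]; omega))
end

section
/- (Dehornoy) For every n ≥ 1 the braid group B_n admits a left-invariant linear order: there exists a strict linear ordering < of the elements of B_n such that f < g implies h·f < h·g for all f, g, h ∈ B_n. -/
/-- A group is left-orderable if it has a positive cone. -/
def IsLeftOrderable (G : Type*) [Group G] : Prop :=
  ∃ P : G → Prop, (∀ a b, P a → P b → P (a * b)) ∧ ¬ P 1 ∧ ∀ a, a ≠ 1 → P a ∨ P a⁻¹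

namespace IsLeftOrderable

variable {G H : Type*} [Group G] [Group H]

theorem of_injective (h : IsLeftOrderable H) (f : G →* H) (hf : Function.Injective f) :
    IsLeftOrderable G := by
  obtain ⟨P, hmul, hone, htot⟩ := h
  refine ⟨fun g => P (f g), fun a b ha hb => ?_, by simpa using hone, fun a ha => ?_⟩
  · simpa only [map_mul] using hmul _ _ ha hb
  · simpa only [map_inv] using htot (f a) fun h => ha (hf (h.trans f.map_one.symm))

/-- A left order on a subgroup extends along a semigroup `Q` of elements that are larger than
the subgroup. -/
theorem of_subgroup (S : Subgroup G) (hS : IsLeftOrderable S) (Q : G → Prop)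
    (hmul : ∀ a b, Q a → Q b → Q (a * b)) (hleft : ∀ a b, a ∈ S → Q b → Q (a * b))
    (hright : ∀ a b, Q a → b ∈ S → Q (a * b)) (hdisj : ∀ a ∈ S, ¬ Q a)
    (htot : ∀ a, a ∉ S → Q a ∨ Q a⁻¹) : IsLeftOrderable G := by
  obtain ⟨P, Pmul, Pone, Ptot⟩ := hS
  refine ⟨fun g => Q g ∨ ∃ h : g ∈ S, P ⟨g, h⟩, ?_, ?_, fun a ha => ?_⟩
  · rintro a b (ha | ⟨ha, Pa⟩) (hb | ⟨hb, Pb⟩)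
    · exact .inl (hmul a b ha hb)
    · exact .inl (hright a b ha hb)
    · exact .inl (hleft a b ha hb)
    · exact .inr ⟨S.mul_mem ha hb, Pmul _ _ Pa Pb⟩
  · rintro (h | ⟨h, h'⟩)
    · exact hdisj 1 S.one_mem h
    · exact Pone h'
  · by_cases h : a ∈ S
    · rcases Ptot ⟨a, h⟩ (fun h' => ha (congrArg Subtype.val h')) with h' | h'
      · exact .inl (.inr ⟨h, h'⟩)
      · exact .inr (.inr ⟨S.inv_mem h, h'⟩)
    · exact (htot a h).imp .inl .inl

theorem semidirectProduct {N : Type*} [Group N] (hN : IsLeftOrderable N)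
    (hG : IsLeftOrderable G) (φ : G →* MulAut N) : IsLeftOrderable (N ⋊[φ] G) := by
  obtain ⟨P, hmul, hone, htot⟩ := hG
  refine of_subgroup (SemidirectProduct.rightHom : N ⋊[φ] G →* G).ker ?_
    (fun g => P g.right) (fun a b ha hb => hmul _ _ ha hb) ?_ ?_ ?_ ?_
  · rw [← SemidirectProduct.range_inl_eq_ker_rightHom]
    exact hN.of_injective
      (MonoidHom.ofInjective (SemidirectProduct.inl_injective (φ := φ))).symm.toMonoidHom
      (MulEquiv.injective _)
  · intro a b ha hb
    rw [MonoidHom.mem_ker, SemidirectProduct.rightHom_eq_right] at ha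
    simpa [ha] using hb
  · intro a b ha hb
    rw [MonoidHom.mem_ker, SemidirectProduct.rightHom_eq_right] at hb
    simpa [hb] using ha
  · intro a ha
    rw [MonoidHom.mem_ker, SemidirectProduct.rightHom_eq_right] at ha
    simpa [ha] using hone
  · intro a ha
    exact htot _ ha

/-- If `G` acts on an ordered group by automorphisms preserving the positive cone, and the
stabilizer of a point is left-orderable, then `G` is left-orderable. -/
theorem of_stabilizer {N : Type*} [Group N] (φ : G →* MulAut N) (P : N → Prop)
    (hmul : ∀ a b, P a → P b → P (a * b)) (hone : ¬ P 1) (htot : ∀ a, a ≠ 1 → P a ∨ P a⁻¹)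
    (hφ : ∀ g a, P a → P (φ g a)) (x : N) (S : Subgroup G) (hS : IsLeftOrderable S)
    (hx : ∀ g, φ g x = x → g ∈ S) : IsLeftOrderable G := by
  let T : Subgroup G :=
    { carrier := {g | φ g x = x}
      one_mem' := by simp
      mul_mem' := fun {a b} ha hb => by
        simp only [Set.mem_ofPred_eq] at *
        rw [map_mul, MulAut.mul_apply, hb, ha]
      inv_mem' := fun {a} ha => by
        simp only [Set.mem_ofPred_eq] at *
        rw [map_inv, MulAut.inv_apply, MulEquiv.symm_apply_eq, ha] }
  have hT : IsLeftOrderable T :=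
    hS.of_injective (Subgroup.inclusion fun g hg => hx g hg) (Subgroup.inclusion_injective _)
  have key : ∀ a b, x⁻¹ * φ (a * b) x = (x⁻¹ * φ a x) * φ a (x⁻¹ * φ b x) := fun a b => by
    simp [mul_assoc]
  refine of_subgroup T hT (fun g => P (x⁻¹ * φ g x)) ?_ ?_ ?_ ?_ ?_
  · intro a b ha hb
    rw [key]
    exact hmul _ _ ha (hφ _ _ hb)
  · intro a b ha hb
    have ha : φ a x = x := ha
    rw [key, ha, inv_mul_cancel, one_mul]
    exact hφ _ _ hb
  · intro a b ha hb
    have hb : φ b x = x := hb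
    rwa [map_mul, MulAut.mul_apply, hb]
  · intro a ha
    have ha : φ a x = x := ha
    rwa [ha, inv_mul_cancel]
  · intro a ha
    have ha : ¬ φ a x = x := ha
    refine (htot (x⁻¹ * φ a x) fun h => ha (inv_mul_eq_one.1 h).symm).imp_right fun h => ?_
    have := hφ a⁻¹ _ h
    simpa using this

/-- The strict order attached to a positive cone. -/
theorem exists_isStrictTotalOrder (h : IsLeftOrderable G) :
    ∃ r : G → G → Prop, IsStrictTotalOrder G r ∧ ∀ f g h : G, r f g → r (h * f) (h * g) := by
  obtain ⟨P, hmul, hone, htot⟩ := h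
  refine ⟨fun f g => P (f⁻¹ * g), ?_, fun f g h hfg => by simpa [mul_assoc] using hfg⟩
  have irr : ∀ a : G, ¬ P (a⁻¹ * a) := fun a => by simpa using hone
  have tr : ∀ a b c : G, P (a⁻¹ * b) → P (b⁻¹ * c) → P (a⁻¹ * c) := fun a b c hab hbc => by
    simpa [mul_assoc] using hmul _ _ hab hbc
  exact
    { irrefl := irr
      trans := tr
      trichotomous := fun a b hab hba => by
        by_contra hne
        rcases htot (a⁻¹ * b) (fun h => hne (inv_mul_eq_one.1 h)) with h | h
        · exact hab h
        · exact hba (by simpa using h) }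

end IsLeftOrderable

namespace FreeGroup

/-- The positions of the letters `x₀ < x₀⁻¹ < x₁ < x₁⁻¹ < ⋯` around a vertex of the planar
Cayley tree of the free group. -/
def letterRank (p : ℕ × Bool) : ℤ := 2 * p.1 + if p.2 then 0 else 1

/-- The sign of the turn made at a vertex by a path that traverses `p` and then `q`. -/
def turn (p q : ℕ × Bool) : ℤ :=
  if letterRank q < letterRank (p.1, !p.2) then 1
  else if letterRank (p.1, !p.2) < letterRank q then -1 else 0

/-- The exponent of a letter. -/
def letterSign (p : ℕ × Bool) : ℤ := if p.2 then 1 else -1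

/-- The exponent sum of a word plus its total turning number. -/
def wordWeight : List (ℕ × Bool) → ℤ
  | [] => 0
  | [p] => letterSign p
  | p :: q :: l => letterSign p + turn p q + wordWeight (q :: l)

theorem wordWeight_append_cons_cons (u v : List (ℕ × Bool)) (p q : ℕ × Bool) :
    wordWeight (u ++ p :: q :: v) = wordWeight (u ++ [p]) + turn p q + wordWeight (q :: v) := by
  induction u with
  | nil => simp [wordWeight]
  | cons a u ih =>
    cases u with
    | nil => simp [wordWeight]; ring
    | cons b u =>
      simp only [List.cons_append, wordWeight] at ih ⊢
      rw [ih]; ring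

theorem turn_inv (p q : ℕ × Bool) : turn (q.1, !q.2) (p.1, !p.2) = - turn p q := by
  simp only [turn, Bool.not_not, Prod.mk.eta]
  split_ifs <;> omega

theorem wordWeight_invRev (l : List (ℕ × Bool)) : wordWeight (invRev l) = - wordWeight l := by
  induction l with
  | nil => rfl
  | cons p l ih =>
    cases l with
    | nil => cases h : p.2 <;> simp [invRev, wordWeight, letterSign, h]
    | cons q l =>
      have h1 : invRev (p :: q :: l) = invRev l ++ (q.1, !q.2) :: (p.1, !p.2) :: [] := by
        simp [invRev]
      have h2 : invRev (q :: l) = invRev l ++ [(q.1, !q.2)] := by simp [invRev]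
      rw [h1, wordWeight_append_cons_cons, ← h2, ih, turn_inv]
      cases h : p.2 <;> simp [wordWeight, letterSign, h] <;> ring

theorem exists_reduce_append {α : Type*} [DecidableEq α] (L M : List (α × Bool))
    (hL : IsReduced L) (hM : IsReduced M) :
    ∃ u k v, L = u ++ k ∧ M = invRev k ++ v ∧ reduce (L ++ M) = u ++ v := by
  induction L using List.reverseRecOn generalizing M with
  | nil => exact ⟨[], [], M, rfl, rfl, hM.reduce_eq⟩
  | append_singleton L p ih =>
    cases M with
    | nil => exact ⟨L ++ [p], [], [], by simp, rfl, by simpa using hL.reduce_eq⟩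
    | cons q M =>
      by_cases h : q = (p.1, !p.2)
      · obtain ⟨u, k, v, h1, h2, h3⟩ := ih M (List.isChain_append.1 hL).1 (List.isChain_cons.1 hM).2
        refine ⟨u, k ++ [p], v, by simp [h1], by simp [h2, h, invRev], ?_⟩
        rw [← h3, h]
        have : Red.Step (L ++ (p.1, p.2) :: (p.1, !p.2) :: M) (L ++ M) := Red.Step.not
        simpa using reduce.Step.eq this
      · refine ⟨L ++ [p], [], q :: M, by simp, rfl, ?_⟩
        apply IsReduced.reduce_eq
        rw [List.append_assoc, List.singleton_append]
        refine List.isChain_append_cons_cons.2 ⟨hL, fun h1 => ?_, hM⟩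
        by_contra h2
        exact h (Prod.ext h1.symm (by cases hp : p.2 <;> cases hq : q.2 <;> simp_all))

theorem turn_add_turn_sub_turn_le (p q r : ℕ × Bool) :
    turn p q + turn (q.1, !q.2) r - turn p r ≤ 1 := by
  simp only [turn, Bool.not_not, Prod.mk.eta]
  split_ifs <;> omega

theorem turn_mem_Icc (p q : ℕ × Bool) : turn p q ∈ Set.Icc (-1 : ℤ) 1 := by
  simp only [turn]
  split_ifs <;> simp

/-- The weight of a free group element; its positivity defines a left order. -/
def weight (g : FreeGroup ℕ) : ℤ := wordWeight g.toWord

theorem weight_one : weight 1 = 0 := rfl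

theorem weight_inv (g : FreeGroup ℕ) : weight g⁻¹ = - weight g := by
  rw [weight, toWord_inv, wordWeight_invRev, weight]

theorem weight_add_weight_sub_one_le (g h : FreeGroup ℕ) :
    weight g + weight h - 1 ≤ weight (g * h) := by
  obtain ⟨u, k, v, h1, h2, h3⟩ := exists_reduce_append g.toWord h.toWord isReduced_toWord
    isReduced_toWord
  have key : ∀ a b c, a = u ++ k → b = invRev k ++ v → c = u ++ v →
      wordWeight a + wordWeight b - 1 ≤ wordWeight c := by
    rintro _ _ _ rfl rfl rfl
    have hk := wordWeight_invRev k
    rcases List.eq_nil_or_concat' u with rfl | ⟨u, p, rfl⟩ <;>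
    rcases v with _ | ⟨r, v⟩ <;>
    rcases k with _ | ⟨q, k⟩ <;>
    simp only [List.append_nil, List.nil_append, invRev_empty, List.append_assoc,
      List.singleton_append, wordWeight_append_cons_cons]
    · simp [wordWeight]
    · simp only [wordWeight]; omega
    · simp [wordWeight]
    · have : invRev (q :: k) = invRev k ++ [(q.1, !q.2)] := by simp [invRev]
      have h := turn_mem_Icc (q.1, !q.2) r
      rw [this] at hk ⊢
      rw [List.append_assoc, List.singleton_append, wordWeight_append_cons_cons, hk]
      simp only [Set.mem_Icc] at h
      omega
    · simp [wordWeight]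
    · have h := turn_mem_Icc p q
      simp only [Set.mem_Icc] at h
      omega
    · have h := turn_mem_Icc p r
      simp only [Set.mem_Icc] at h
      omega
    · have : invRev (q :: k) = invRev k ++ [(q.1, !q.2)] := by simp [invRev]
      have h := turn_add_turn_sub_turn_le p q r
      rw [this] at hk ⊢
      rw [List.append_assoc, List.singleton_append, wordWeight_append_cons_cons, hk]
      omega
  exact key _ _ _ h1 h2 (by rw [toWord_mul, h3])

theorem weight_ne_zero {g : FreeGroup ℕ} (hg : g ≠ 1) : weight g ≠ 0 := by
  have key : ∀ (l : List (ℕ × Bool)) (p : ℕ × Bool), IsReduced (p :: l) →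
      wordWeight (p :: l) % 2 = 1 := by
    intro l
    induction l with
    | nil => intro p _; cases h : p.2 <;> simp [wordWeight, letterSign, h]
    | cons q l ih =>
      intro p hp
      have hp := List.isChain_cons_cons.1 hp
      have h1 := ih q hp.2
      have h2 : turn p q % 2 = 1 := by
        have h3 : letterRank q ≠ letterRank (p.1, !p.2) := by
          rcases p with ⟨p, _ | _⟩ <;> rcases q with ⟨q, _ | _⟩ <;>
            simp [letterRank] at hp ⊢ <;> omega
        simp only [turn]
        split_ifs <;> omega
      have h3 : letterSign p % 2 = 1 := by cases h : p.2 <;> simp [letterSign, h]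
      simp only [wordWeight]
      omega
  have hne : g.toWord ≠ [] := fun h => hg (toWord_eq_nil_iff.1 h)
  obtain ⟨p, l, h⟩ := List.exists_cons_of_ne_nil hne
  have := key l p (h ▸ isReduced_toWord)
  rw [weight, h]
  omega

theorem weight_mul_pos {g h : FreeGroup ℕ} (hg : 0 < weight g) (hh : 0 < weight h) :
    0 < weight (g * h) := by
  have := weight_add_weight_sub_one_le g h
  omega

theorem weight_pos_or_weight_inv_pos {g : FreeGroup ℕ} (hg : g ≠ 1) :
    0 < weight g ∨ 0 < weight g⁻¹ := by
  have := weight_ne_zero hg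
  rw [weight_inv]
  omega

theorem isLeftOrderable : IsLeftOrderable (FreeGroup ℕ) :=
  ⟨fun g => 0 < weight g, fun _ _ => weight_mul_pos, by simp [weight_one],
    fun _ => weight_pos_or_weight_inv_pos⟩

end FreeGroup

namespace FreeGroup

/-- The Artin endomorphism of the free group attached to `σᵢ`. -/
def artinHom (i : ℕ) : FreeGroup ℕ →* FreeGroup ℕ :=
  lift fun j => if j = i then of (i + 1)
    else if j = i + 1 then (of (i + 1))⁻¹ * of i * of (i + 1) else of j

/-- The Artin endomorphism of the free group attached to `σᵢ⁻¹`. -/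
def artinInvHom (i : ℕ) : FreeGroup ℕ →* FreeGroup ℕ :=
  lift fun j => if j = i then of i * of (i + 1) * (of i)⁻¹
    else if j = i + 1 then of i else of j

/-- `ArtinShape i p R` describes how the reduced image `R` under `artinInvHom i` of a reduced word
with first letter `p` begins. -/
inductive ArtinShape (i : ℕ) : ℕ × Bool → List (ℕ × Bool) → Prop
  | left (s : Bool) (R) : ArtinShape i (i, s) ((i, true) :: (i + 1, s) :: R)
  | right_nil : ArtinShape i (i + 1, true) [(i, true)]
  | right_left (R) : ArtinShape i (i + 1, true) ((i, true) :: (i, true) :: R)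
  | right_other (k : ℕ) (s : Bool) (R) (h : k ≠ i) (h' : k ≠ i + 1) :
      ArtinShape i (i + 1, true) ((i, true) :: (k, s) :: R)
  | rightInv_right (s : Bool) (R) : ArtinShape i (i + 1, false) ((i + 1, s) :: R)
  | rightInv_left (R) : ArtinShape i (i + 1, false) ((i, false) :: R)
  | other (k : ℕ) (s : Bool) (R) (h : k ≠ i) (h' : k ≠ i + 1) : ArtinShape i (k, s) ((k, s) :: R)

theorem mk_cons_true {α : Type*} (k : α) (L : List (α × Bool)) :
    mk ((k, true) :: L) = of k * mk L := rfl

theorem mk_cons_false {α : Type*} (k : α) (L : List (α × Bool)) :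
    mk ((k, false) :: L) = (of k)⁻¹ * mk L := rfl

theorem mk_nil {α : Type*} : (mk [] : FreeGroup α) = 1 := rfl

theorem ArtinShape.cons_left {i : ℕ} (s : Bool) {q : ℕ × Bool} {R : List (ℕ × Bool)}
    (hpq : i = q.1 → s = q.2) (hq : ArtinShape i q R) (hR : IsReduced R) :
    ∃ R', ArtinShape i (i, s) R' ∧ IsReduced R' ∧
      mk R' = artinInvHom i (mk [(i, s)]) * mk R ∧
      wordWeight R' = letterSign (i, s) + turn (i, s) q + wordWeight R := by
  cases s
  · rcases hq with ⟨_ | _, R⟩ | _ | R | ⟨l, _ | _, R, h, h'⟩ | ⟨_ | _, R⟩ | R |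
      ⟨l, _ | _, R, h, h'⟩ <;>
      [refine ⟨_, .left false ((i + 1, false) :: R), ?_⟩;
       simp at hpq;
       refine ⟨_, .left false [], ?_⟩;
       refine ⟨_, .left false ((i, true) :: R), ?_⟩;
       refine ⟨_, .left false ((l, false) :: R), ?_⟩;
       refine ⟨_, .left false ((l, true) :: R), ?_⟩;
       refine ⟨_, .left false ((i, false) :: (i + 1, false) :: R), ?_⟩;
       refine ⟨_, .left false ((i, false) :: (i + 1, true) :: R), ?_⟩;
       refine ⟨_, .left false ((i, false) :: (i, false) :: R), ?_⟩;
       refine ⟨_, .left false ((i, false) :: (l, false) :: R), ?_⟩;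
       refine ⟨_, .left false ((i, false) :: (l, true) :: R), ?_⟩]
    all_goals refine ⟨?_, ?_, ?_⟩
    all_goals first
      | (simp_all [isReduced_cons_cons]; done)
      | (simp_all [isReduced_cons_cons]; omega)
      | (simp_all [mul_assoc, artinInvHom, mk_cons_true, mk_cons_false, mk_nil]; done)
      | (simp_all [wordWeight, turn, letterRank, letterSign]; done)
      | (simp_all [wordWeight, turn, letterRank, letterSign]; split_ifs <;> omega)
  · rcases hq with ⟨_ | _, R⟩ | _ | R | ⟨l, _ | _, R, h, h'⟩ | ⟨_ | _, R⟩ | R |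
      ⟨l, _ | _, R, h, h'⟩ <;>
      [simp at hpq;
       refine ⟨_, .left true ((i + 1, true) :: R), ?_⟩;
       refine ⟨_, .left true [], ?_⟩;
       refine ⟨_, .left true ((i, true) :: R), ?_⟩;
       refine ⟨_, .left true ((l, false) :: R), ?_⟩;
       refine ⟨_, .left true ((l, true) :: R), ?_⟩;
       refine ⟨_, .left true ((i, false) :: (i + 1, false) :: R), ?_⟩;
       refine ⟨_, .left true ((i, false) :: (i + 1, true) :: R), ?_⟩;
       refine ⟨_, .left true ((i, false) :: (i, false) :: R), ?_⟩;
       refine ⟨_, .left true ((i, false) :: (l, false) :: R), ?_⟩;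
       refine ⟨_, .left true ((i, false) :: (l, true) :: R), ?_⟩]
    all_goals refine ⟨?_, ?_, ?_⟩
    all_goals first
      | (simp_all [isReduced_cons_cons]; done)
      | (simp_all [isReduced_cons_cons]; omega)
      | (simp_all [mul_assoc, artinInvHom, mk_cons_true, mk_cons_false, mk_nil]; done)
      | (simp_all [wordWeight, turn, letterRank, letterSign]; done)
      | (simp_all [wordWeight, turn, letterRank, letterSign]; split_ifs <;> omega)

theorem ArtinShape.cons_right {i : ℕ} (s : Bool) {q : ℕ × Bool} {R : List (ℕ × Bool)}
    (hpq : i + 1 = q.1 → s = q.2) (hq : ArtinShape i q R) (hR : IsReduced R) :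
    ∃ R', ArtinShape i (i + 1, s) R' ∧ IsReduced R' ∧
      mk R' = artinInvHom i (mk [(i + 1, s)]) * mk R ∧
      wordWeight R' = letterSign (i + 1, s) + turn (i + 1, s) q + wordWeight R := by
  cases s
  · rcases hq with ⟨_ | _, R⟩ | _ | R | ⟨l, _ | _, R, h, h'⟩ | ⟨_ | _, R⟩ | R |
      ⟨l, _ | _, R, h, h'⟩ <;>
      [refine ⟨_, .rightInv_right false R, ?_⟩;
       refine ⟨_, .rightInv_right true R, ?_⟩;
       simp at hpq;
       simp at hpq;
       simp at hpq;
       simp at hpq;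
       refine ⟨_, .rightInv_left ((i + 1, false) :: R), ?_⟩;
       refine ⟨_, .rightInv_left ((i + 1, true) :: R), ?_⟩;
       refine ⟨_, .rightInv_left ((i, false) :: R), ?_⟩;
       refine ⟨_, .rightInv_left ((l, false) :: R), ?_⟩;
       refine ⟨_, .rightInv_left ((l, true) :: R), ?_⟩]
    all_goals refine ⟨?_, ?_, ?_⟩
    all_goals first
      | (simp_all [isReduced_cons_cons]; done)
      | (simp_all [isReduced_cons_cons]; omega)
      | (simp_all [mul_assoc, artinInvHom, mk_cons_true, mk_cons_false, mk_nil]; done)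
      | (simp_all [wordWeight, turn, letterRank, letterSign]; done)
      | (simp_all [wordWeight, turn, letterRank, letterSign]; split_ifs <;> omega)
  · rcases hq with ⟨_ | _, R⟩ | _ | R | ⟨l, _ | _, R, h, h'⟩ | ⟨_ | _, R⟩ | R |
      ⟨l, _ | _, R, h, h'⟩ <;>
      [refine ⟨_, .right_left ((i + 1, false) :: R), ?_⟩;
       refine ⟨_, .right_left ((i + 1, true) :: R), ?_⟩;
       refine ⟨_, .right_left [], ?_⟩;
       refine ⟨_, .right_left ((i, true) :: R), ?_⟩;
       refine ⟨_, .right_left ((l, false) :: R), ?_⟩;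
       refine ⟨_, .right_left ((l, true) :: R), ?_⟩;
       simp at hpq;
       simp at hpq;
       simp at hpq;
       refine ⟨_, .right_other l false R h h', ?_⟩;
       refine ⟨_, .right_other l true R h h', ?_⟩]
    all_goals refine ⟨?_, ?_, ?_⟩
    all_goals first
      | (simp_all [isReduced_cons_cons]; done)
      | (simp_all [isReduced_cons_cons]; omega)
      | (simp_all [mul_assoc, artinInvHom, mk_cons_true, mk_cons_false, mk_nil]; done)
      | (simp_all [wordWeight, turn, letterRank, letterSign]; done)
      | (simp_all [wordWeight, turn, letterRank, letterSign]; split_ifs <;> omega)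

theorem ArtinShape.cons_other {i k : ℕ} (s : Bool) {q : ℕ × Bool} {R : List (ℕ × Bool)} (hk : k ≠ i)
    (hk' : k ≠ i + 1) (hpq : k = q.1 → s = q.2) (hq : ArtinShape i q R) (hR : IsReduced R) :
    ∃ R', ArtinShape i (k, s) R' ∧ IsReduced R' ∧ mk R' = artinInvHom i (mk [(k, s)]) * mk R ∧
      wordWeight R' = letterSign (k, s) + turn (k, s) q + wordWeight R := by
  refine ⟨_, .other k s R hk hk', ?_, ?_, ?_⟩
  · rcases hq with ⟨_ | _, R⟩ | _ | R | ⟨l, _ | _, R, h, h'⟩ | ⟨_ | _, R⟩ | R |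
      ⟨l, _ | _, R, h, h'⟩ <;>
      simp_all [isReduced_cons_cons]
  · cases s <;> simp [artinInvHom, mk_cons_true, mk_cons_false, mk_nil, hk, hk']
  · have key : ∀ (r : ℕ × Bool) (T : List (ℕ × Bool)), turn (k, s) r = turn (k, s) q →
        wordWeight ((k, s) :: r :: T) = letterSign (k, s) + turn (k, s) q + wordWeight (r :: T) :=
      fun r T h => by rw [wordWeight, h]
    rcases hq with ⟨_ | _, R⟩ | _ | R | ⟨l, _ | _, R, h, h'⟩ | ⟨_ | _, R⟩ | R |
      ⟨l, _ | _, R, h, h'⟩ <;>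
      refine key _ _ ?_ <;> clear key hR hpq <;> cases s <;>
      simp only [turn, letterRank, Bool.not_true, Bool.not_false, if_true, if_false,
        Bool.false_eq_true] <;> split_ifs <;> first | rfl | omega

theorem ArtinShape.cons {i : ℕ} {p q : ℕ × Bool} {R : List (ℕ × Bool)}
    (hpq : p.1 = q.1 → p.2 = q.2) (hq : ArtinShape i q R) (hR : IsReduced R) :
    ∃ R', ArtinShape i p R' ∧ IsReduced R' ∧ mk R' = artinInvHom i (mk [p]) * mk R ∧
      wordWeight R' = letterSign p + turn p q + wordWeight R := by
  obtain ⟨k, s⟩ := p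
  by_cases hk : k = i
  · subst hk
    exact cons_left s hpq hq hR
  by_cases hk' : k = i + 1
  · subst hk'
    exact cons_right s hpq hq hR
  · exact cons_other s hk hk' hpq hq hR

theorem ArtinShape.singleton (i : ℕ) (p : ℕ × Bool) :
    ∃ R, ArtinShape i p R ∧ IsReduced R ∧ mk R = artinInvHom i (mk [p]) ∧
      wordWeight R = wordWeight [p] := by
  obtain ⟨k, s⟩ := p
  by_cases hk : k = i
  · subst hk
    refine ⟨_, .left s [(k, false)], ?_, ?_, ?_⟩ <;> cases s
    all_goals simp [isReduced_cons_cons, mul_assoc, artinInvHom, mk_cons_true, mk_cons_false,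
      mk_nil, wordWeight, turn, letterRank, letterSign]
    all_goals omega
  by_cases hk' : k = i + 1
  · subst hk'
    cases s
    · refine ⟨_, .rightInv_left [], ?_, ?_, ?_⟩
      all_goals simp [artinInvHom, mk_cons_false, mk_nil, wordWeight, letterSign]
    · refine ⟨_, .right_nil, ?_, ?_, ?_⟩
      all_goals simp [artinInvHom, mk_cons_true, mk_nil, wordWeight, letterSign]
  · refine ⟨_, .other k s [] hk hk', ?_, ?_, rfl⟩ <;> cases s
    all_goals simp [artinInvHom, mk_cons_true, mk_cons_false, mk_nil, hk, hk']

theorem weight_artinInvHom (i : ℕ) (g : FreeGroup ℕ) : weight (artinInvHom i g) = weight g := by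
  have key : ∀ (l : List (ℕ × Bool)) (p : ℕ × Bool), IsReduced (p :: l) →
      ∃ R, ArtinShape i p R ∧ IsReduced R ∧ mk R = artinInvHom i (mk (p :: l)) ∧
        wordWeight R = wordWeight (p :: l) := by
    intro l
    induction l with
    | nil => exact fun p _ => ArtinShape.singleton i p
    | cons q l ih =>
      intro p hp
      rw [isReduced_cons_cons] at hp
      obtain ⟨R, h1, h2, h3, h4⟩ := ih q hp.2
      obtain ⟨R', h1', h2', h3', h4'⟩ := h1.cons hp.1 h2
      refine ⟨R', h1', h2', ?_, by rw [h4', h4, wordWeight]⟩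
      rw [h3', h3, ← _root_.map_mul, mul_mk, List.singleton_append]
  rcases h : g.toWord with _ | ⟨p, l⟩
  · rw [toWord_eq_nil_iff.1 h, _root_.map_one]
  · obtain ⟨R, -, h2, h3, h4⟩ := key l p (h ▸ isReduced_toWord)
    rw [← h, mk_toWord] at h3
    rw [weight, ← h3, toWord_mk, h2.reduce_eq, h4, weight, h]

/-- The Artin automorphism `xᵢ ↦ xᵢ₊₁`, `xᵢ₊₁ ↦ xᵢ₊₁⁻¹ xᵢ xᵢ₊₁` of the free group. -/
def artin (i : ℕ) : MulAut (FreeGroup ℕ) :=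
  MonoidHom.toMulEquiv (artinHom i) (artinInvHom i)
    (by
      ext j
      by_cases h : j = i
      · simp [artinHom, artinInvHom, h]
      · by_cases h' : j = i + 1 <;> simp [artinHom, artinInvHom, h, h', mul_assoc])
    (by
      ext j
      by_cases h : j = i
      · simp [artinHom, artinInvHom, h, mul_assoc]
      · by_cases h' : j = i + 1 <;> simp [artinHom, artinInvHom, h, h', mul_assoc])

theorem weight_artin_symm (i : ℕ) (g : FreeGroup ℕ) : weight ((artin i).symm g) = weight g :=
  weight_artinInvHom i g

theorem weight_artin (i : ℕ) (g : FreeGroup ℕ) : weight (artin i g) = weight g := by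
  rw [← weight_artin_symm i (artin i g), MulEquiv.symm_apply_apply]

theorem artin_of_self (i : ℕ) : artin i (of i) = of (i + 1) := by
  simp [artin, artinHom]

theorem artin_of_succ (i : ℕ) :
    artin i (of (i + 1)) = (of (i + 1))⁻¹ * of i * of (i + 1) := by
  simp [artin, artinHom]

theorem artin_of_of_ne {i j : ℕ} (h : j ≠ i) (h' : j ≠ i + 1) : artin i (of j) = of j := by
  simp [artin, artinHom, h, h']

end FreeGroup

namespace BraidGroup

/-- The generator `σᵢ` of the braid group on `m` generators, or `1` if `m ≤ i`. -/
def gen (m i : ℕ) : BraidGroup (m + 1) :=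
  if h : i < m then PresentedGroup.of ⟨i, h⟩ else 1

theorem gen_of_le {m i : ℕ} (h : m ≤ i) : gen m i = 1 := dif_neg h.not_gt

theorem gen_comm (m : ℕ) {i k : ℕ} (h : i + 2 ≤ k) : gen m i * gen m k = gen m k * gen m i := by
  by_cases hk : k < m
  · rw [gen, gen, dif_pos hk, dif_pos (by omega)]
    exact PresentedGroup.mk_eq_mk_of_mul_inv_mem (.inl ⟨⟨i, by omega⟩, ⟨k, hk⟩, h, rfl⟩)
  · rw [gen_of_le (not_lt.1 hk), mul_one, one_mul]

theorem gen_braid {m i : ℕ} (h : i + 1 < m) :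
    gen m i * gen m (i + 1) * gen m i = gen m (i + 1) * gen m i * gen m (i + 1) := by
  rw [gen, gen, dif_pos h, dif_pos (by omega)]
  exact PresentedGroup.mk_eq_mk_of_mul_inv_mem (.inr ⟨⟨i, by omega⟩, ⟨i + 1, h⟩, rfl, rfl⟩)

section lift

variable {G : Type*} [Group G] {m : ℕ} (s : ℕ → G)
  (hc : ∀ i k, i + 2 ≤ k → k < m → s i * s k = s k * s i)
  (hb : ∀ i, i + 1 < m → s i * s (i + 1) * s i = s (i + 1) * s i * s (i + 1))

/-- The universal property of the braid group. -/
def lift : BraidGroup (m + 1) →* G :=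
  PresentedGroup.toGroup (f := fun i : Fin (m + 1 - 1) => s i) (by
    rintro _ (⟨i, k, h, rfl⟩ | ⟨i, k, h, rfl⟩)
    · simpa [mul_inv_eq_one] using mul_inv_eq_one.2 (hc i k h k.2)
    · have := hb i (h ▸ k.2)
      rw [h] at this
      simpa [mul_inv_eq_one] using mul_inv_eq_one.2 this)

theorem lift_gen {i : ℕ} (h : i < m) : lift s hc hb (gen m i) = s i := by
  rw [gen, dif_pos h]
  exact PresentedGroup.toGroup.of _

end lift

theorem induction {m : ℕ} {p : BraidGroup (m + 1) → Prop} (one : p 1)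
    (gen_mul : ∀ i < m, ∀ b, p b → p (gen m i * b))
    (inv_mul : ∀ i < m, ∀ b, p b → p ((gen m i)⁻¹ * b)) (b : BraidGroup (m + 1)) : p b := by
  have key : b ∈ Subgroup.closure (Set.range (PresentedGroup.of (rels := braidRels (m + 1)))) := by
    rw [PresentedGroup.closure_range_of]
    trivial
  have hgen : ∀ i : Fin (m + 1 - 1), PresentedGroup.of i = gen m i := fun i => by
    simp only [gen, dif_pos (show (i : ℕ) < m from i.2)]
  induction key using Subgroup.closure_induction_left with
  | one => exact one
  | mul_left x hx y _ ih =>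
    obtain ⟨i, rfl⟩ := hx
    exact hgen i ▸ gen_mul i i.2 y ih
  | inv_mul_cancel x hx y _ ih =>
    obtain ⟨i, rfl⟩ := hx
    exact hgen i ▸ inv_mul i i.2 y ih

end BraidGroup

namespace FreeGroup

theorem mulAut_ext {f g : MulAut (FreeGroup ℕ)} (h : ∀ j, f (of j) = g (of j)) : f = g :=
  MulEquiv.toMonoidHom_injective (ext_hom _ _ h)

theorem artin_comm {i k : ℕ} (h : i + 2 ≤ k) : artin i * artin k = artin k * artin i := by
  refine mulAut_ext fun j => ?_
  simp only [MulAut.mul_apply]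
  have h1 : artin i (of k) = of k := artin_of_of_ne (by omega) (by omega)
  have h2 : artin i (of (k + 1)) = of (k + 1) := artin_of_of_ne (by omega) (by omega)
  have h3 : artin k (of i) = of i := artin_of_of_ne (by omega) (by omega)
  have h4 : artin k (of (i + 1)) = of (i + 1) := artin_of_of_ne (by omega) (by omega)
  by_cases hi : j = i
  · simp [hi, artin_of_self, h3, h4]
  by_cases hi' : j = i + 1
  · simp [hi', artin_of_succ, h3, h4]
  by_cases hk : j = k
  · simp [hk, artin_of_self, h1, h2]
  by_cases hk' : j = k + 1
  · simp [hk', artin_of_succ, h1, h2]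
  · simp [artin_of_of_ne, hi, hi', hk, hk']

theorem artin_braid (i : ℕ) :
    artin i * artin (i + 1) * artin i = artin (i + 1) * artin i * artin (i + 1) := by
  refine mulAut_ext fun j => ?_
  simp only [MulAut.mul_apply]
  have h1 : artin i (of (i + 1 + 1)) = of (i + 1 + 1) := artin_of_of_ne (by omega) (by omega)
  have h2 : artin (i + 1) (of i) = of i := artin_of_of_ne (by omega) (by omega)
  by_cases hi : j = i
  · simp [hi, artin_of_self, h1, h2]
  by_cases hi' : j = i + 1
  · simp [hi', artin_of_self, artin_of_succ, h1, h2]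
  by_cases hk : j = i + 1 + 1
  · simp [hk, artin_of_self, artin_of_succ, h1, h2, mul_assoc]
  · simp [artin_of_of_ne, hi, hi', hk]

end FreeGroup

namespace BraidGroup

open FreeGroup (artin)

/-- Artin's action of the braid group on the free group. -/
def action (m : ℕ) : BraidGroup (m + 1) →* MulAut (FreeGroup ℕ) :=
  lift artin (fun _ _ h _ => FreeGroup.artin_comm h) fun i _ => FreeGroup.artin_braid i

theorem action_gen {m i : ℕ} (h : i < m) : action m (gen m i) = artin i :=
  lift_gen _ _ _ h

theorem weight_action {m : ℕ} (b : BraidGroup (m + 1)) (g : FreeGroup ℕ) :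
    (action m b g).weight = g.weight := by
  induction b using induction with
  | one => simp
  | gen_mul i h b ih => rw [map_mul, MulAut.mul_apply, action_gen h, FreeGroup.weight_artin, ih]
  | inv_mul i h b ih =>
    rw [map_mul, MulAut.mul_apply, map_inv, action_gen h, MulAut.inv_apply,
      FreeGroup.weight_artin_symm, ih]

/-- The group of braids on one more strand that fix a strand, presented as a semidirect
product. -/
abbrev Split (m : ℕ) : Type := FreeGroup ℕ ⋊[action m] BraidGroup (m + 1)

namespace Split

variable {m : ℕ}

/-- The generator `σᵢ` of the braid factor. -/
def s (m i : ℕ) : Split m := SemidirectProduct.inr (gen m i)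

/-- The generator `xᵢ` of the free factor. -/
def x (m i : ℕ) : Split m := SemidirectProduct.inl (FreeGroup.of i)

theorem s_mul_inl {i : ℕ} (h : i < m) (g : FreeGroup ℕ) :
    s m i * SemidirectProduct.inl g = SemidirectProduct.inl (artin i g) * s m i := by
  rw [s, ← action_gen h, SemidirectProduct.inl_aut, map_inv, inv_mul_cancel_right]

theorem s_comm {i k : ℕ} (h : i + 2 ≤ k) : s m i * s m k = s m k * s m i := by
  simp only [s, ← map_mul, gen_comm m h]

theorem s_braid {i : ℕ} (h : i + 1 < m) :
    s m i * s m (i + 1) * s m i = s m (i + 1) * s m i * s m (i + 1) := by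
  simp only [s, ← map_mul, gen_braid h]

theorem s_mul_x_self {i : ℕ} (h : i < m) : s m i * x m i = x m (i + 1) * s m i := by
  rw [x, s_mul_inl h, FreeGroup.artin_of_self, x]

theorem s_mul_x_mul_x {i : ℕ} (h : i < m) :
    s m i * (x m i * x m (i + 1)) = x m i * x m (i + 1) * s m i := by
  rw [x, x, ← map_mul, s_mul_inl h, map_mul, FreeGroup.artin_of_self, FreeGroup.artin_of_succ]
  simp [mul_assoc]

theorem s_mul_x_of_ne {i k : ℕ} (h : i < m) (hk : k ≠ i) (hk' : k ≠ i + 1) :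
    s m i * x m k = x m k * s m i := by
  rw [x, s_mul_inl h, FreeGroup.artin_of_of_ne hk hk']

/-- The label of the strand at position `j` in `σᵢ`. -/
def label (m i j : ℕ) : Split m :=
  if m + 1 < j then 1 else if j < i then s m (i - 1) else if j = i then 1
    else if j = i + 1 then x m i else s m i

/-- The labelled permutation attached to `σᵢ`. -/
def step (m i : ℕ) : Equiv.Perm (ℕ × Split m) :=
  Equiv.prodShear (Equiv.swap i (i + 1)) fun j => Equiv.mulLeft (label m i j)

theorem step_apply (i j : ℕ) (g : Split m) :
    step m i (j, g) = (Equiv.swap i (i + 1) j, label m i j * g) := rfl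

theorem step_apply_self {i : ℕ} (h : i < m + 1) (g : Split m) : step m i (i, g) = (i + 1, g) := by
  rw [step_apply, Equiv.swap_apply_left, label, if_neg (by omega), if_neg (by omega), if_pos rfl,
    one_mul]

theorem step_apply_succ {i : ℕ} (h : i < m + 1) (g : Split m) :
    step m i (i + 1, g) = (i, x m i * g) := by
  rw [step_apply, Equiv.swap_apply_right, label, if_neg (by omega), if_neg (by omega),
    if_neg (by omega), if_pos rfl]

theorem step_apply_of_lt {i j : ℕ} (h : i < m + 1) (hj : j < i) (g : Split m) :
    step m i (j, g) = (j, s m (i - 1) * g) := by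
  rw [step_apply, Equiv.swap_apply_of_ne_of_ne (by omega) (by omega), label, if_neg (by omega),
    if_pos hj]

theorem step_succ_apply_of_le {i j : ℕ} (h : i + 1 < m + 1) (hj : j ≤ i) (g : Split m) :
    step m (i + 1) (j, g) = (j, s m i * g) :=
  step_apply_of_lt h (Nat.lt_succ_of_le hj) g

theorem step_apply_of_gt {i j : ℕ} (hj : i + 1 < j) (hj' : j ≤ m + 1) (g : Split m) :
    step m i (j, g) = (j, s m i * g) := by
  rw [step_apply, Equiv.swap_apply_of_ne_of_ne (by omega) (by omega), label, if_neg (by omega),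
    if_neg (by omega), if_neg (by omega), if_neg (by omega)]

theorem step_apply_of_gt_last {i j : ℕ} (h : i < m + 1) (hj : m + 1 < j) (g : Split m) :
    step m i (j, g) = (j, g) := by
  rw [step_apply, Equiv.swap_apply_of_ne_of_ne (by omega) (by omega), label, if_pos hj, one_mul]

theorem step_comm {i k : ℕ} (h : i + 2 ≤ k) (hk : k < m + 1) :
    step m i * step m k = step m k * step m i := by
  ext1 ⟨j, g⟩
  have hi : i < m + 1 := by omega
  simp only [Equiv.Perm.mul_apply]
  rcases lt_trichotomy j i with hj | rfl | hj
  · rw [step_apply_of_lt hk (by omega), step_apply_of_lt hi hj, step_apply_of_lt hi hj,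
      step_apply_of_lt hk (by omega), ← mul_assoc, ← mul_assoc, s_comm (by omega)]
  · rw [step_apply_of_lt hk (by omega), step_apply_self hi, step_apply_self hi,
      step_apply_of_lt hk (by omega)]
  rcases (Nat.succ_le_of_lt hj).eq_or_lt with rfl | hj
  · rw [Nat.succ_eq_add_one, step_apply_of_lt hk (by omega), step_apply_succ hi, step_apply_succ hi,
      step_apply_of_lt hk (by omega), ← mul_assoc, ← mul_assoc,
      s_mul_x_of_ne (by omega) (by omega) (by omega)]
  rcases lt_trichotomy j k with hj' | rfl | hj'
  · rw [step_apply_of_lt hk hj', step_apply_of_gt hj (by omega), step_apply_of_gt hj (by omega),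
      step_apply_of_lt hk hj', ← mul_assoc, ← mul_assoc, s_comm (by omega)]
  · rw [step_apply_self hk, step_apply_of_gt (by omega) (by omega),
      step_apply_of_gt hj (by omega), step_apply_self hk]
  rcases (Nat.succ_le_of_lt hj').eq_or_lt with rfl | hj'
  · rw [Nat.succ_eq_add_one, step_apply_succ hk, step_apply_of_gt (j := k) (by omega) (by omega),
      step_apply_of_gt (j := k + 1) (by omega) (by omega), step_apply_succ hk, ← mul_assoc,
      ← mul_assoc, s_mul_x_of_ne (by omega) (by omega) (by omega)]
  by_cases hm : m + 1 < j
  · simp only [step_apply_of_gt_last hi hm, step_apply_of_gt_last hk hm]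
  · rw [step_apply_of_gt hj' (by omega), step_apply_of_gt hj (by omega),
      step_apply_of_gt hj (by omega), step_apply_of_gt hj' (by omega), ← mul_assoc, ← mul_assoc,
      s_comm h]

theorem step_braid {i : ℕ} (h : i + 1 < m + 1) :
    step m i * step m (i + 1) * step m i = step m (i + 1) * step m i * step m (i + 1) := by
  ext1 ⟨j, g⟩
  have hi : i < m + 1 := by omega
  simp only [Equiv.Perm.mul_apply]
  rcases lt_trichotomy j i with hj | rfl | hj
  · obtain ⟨i, rfl⟩ := Nat.exists_eq_succ_of_ne_zero (show i ≠ 0 by omega)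
    simp only [Nat.succ_eq_add_one, step_apply_of_lt hi hj,
      step_succ_apply_of_le h (show j ≤ i + 1 by omega), Nat.add_sub_cancel, ← mul_assoc,
      s_braid (show i + 1 < m by omega)]
  · rw [step_apply_self hi, step_apply_self h,
      step_apply_of_gt (j := j + 1 + 1) (by omega) (by omega), step_succ_apply_of_le h le_rfl,
      step_apply_self hi, step_apply_self h]
  rcases (Nat.succ_le_of_lt hj).eq_or_lt with rfl | hj
  · rw [Nat.succ_eq_add_one, step_apply_succ hi, step_succ_apply_of_le h le_rfl,
      step_apply_self hi, step_apply_self h,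
      step_apply_of_gt (j := i + 1 + 1) (by omega) (by omega), step_apply_succ h, ← mul_assoc,
      ← mul_assoc, s_mul_x_self (by omega)]
  rcases (Nat.succ_le_of_lt hj).eq_or_lt with rfl | hj
  · simp only [Nat.succ_eq_add_one]
    rw [step_apply_of_gt (j := i + 1 + 1) (by omega) (by omega), step_apply_succ h,
      step_apply_succ hi, step_apply_succ h, step_apply_succ hi, step_succ_apply_of_le h le_rfl,
      ← mul_assoc, ← mul_assoc, ← mul_assoc, ← mul_assoc, ← s_mul_x_mul_x (by omega), ← mul_assoc]
  by_cases hm : m + 1 < j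
  · simp only [step_apply_of_gt_last hi hm, step_apply_of_gt_last h hm]
  · simp only [step_apply_of_gt (show i + 1 < j by omega) (not_lt.1 hm),
      step_apply_of_gt (show i + 1 + 1 < j by omega) (not_lt.1 hm), ← mul_assoc,
      s_braid (show i + 1 < m by omega)]

end Split

open Split

/-- The action of the braid group on strands labelled by elements of `Split m`. -/
def strands (m : ℕ) : BraidGroup (m + 2) →* Equiv.Perm (ℕ × Split m) :=
  lift (m := m + 1) (step m) (fun _ _ => step_comm) fun _ => step_braid

theorem strands_gen {m i : ℕ} (h : i < m + 1) : strands m (gen (m + 1) i) = step m i :=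
  lift_gen _ _ _ h

theorem strands_apply_mul {m : ℕ} (b : BraidGroup (m + 2)) (j : ℕ) (g h : Split m) :
    strands m b (j, g * h) = ((strands m b (j, g)).1, (strands m b (j, g)).2 * h) := by
  have hstep : ∀ (i : ℕ) (p : ℕ × Split m),
      step m i (p.1, p.2 * h) = ((step m i p).1, (step m i p).2 * h) := fun i p =>
    Prod.ext rfl (mul_assoc _ _ _).symm
  induction b using induction (m := m + 1) generalizing j g with
  | one => simp
  | gen_mul i hi b ih =>
    rw [map_mul, Equiv.Perm.mul_apply, ih, strands_gen hi, hstep i, Equiv.Perm.mul_apply]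
  | inv_mul i hi b ih =>
    rw [map_mul, Equiv.Perm.mul_apply, ih, map_inv, strands_gen hi, Equiv.Perm.inv_eq_iff_eq,
      hstep i, Equiv.Perm.mul_apply, ← Equiv.Perm.mul_apply, mul_inv_cancel,
      Equiv.Perm.one_apply]

/-- The braid `σⱼ₋₁ ⋯ σ₁ σ₀`. -/
def cycle (m : ℕ) : ℕ → BraidGroup (m + 1)
  | 0 => 1
  | j + 1 => gen m j * cycle m j

theorem gen_mul_cycle_of_lt {m i j : ℕ} (h : j < i) :
    gen m i * cycle m j = cycle m j * gen m i := by
  induction j with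
  | zero => simp [cycle]
  | succ j ih =>
    rw [cycle, ← mul_assoc, ← gen_comm m (by omega), mul_assoc, ih (by omega), mul_assoc]

theorem gen_mul_cycle_of_gt {m i j : ℕ} (hi : i + 1 < m) (h : i + 1 < j) :
    gen m i * cycle m j = cycle m j * gen m (i + 1) := by
  induction j, h using Nat.le_induction with
  | base =>
    rw [cycle, cycle, ← mul_assoc, ← mul_assoc, gen_braid hi, mul_assoc,
      gen_mul_cycle_of_lt (by omega), ← mul_assoc]
    simp only [mul_assoc]
  | succ j hj ih => rw [cycle, ← mul_assoc, gen_comm m (by omega), mul_assoc, ih, mul_assoc]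

/-- The pure braid in which the first strand encircles its `k`-th neighbour. -/
def loop (m k : ℕ) : BraidGroup (m + 1) := (cycle m k)⁻¹ * gen m k ^ 2 * cycle m k

theorem gen_mul_loop_of_ne {m i k : ℕ} (hi : i + 1 < m) (hk : k ≠ i) (hk' : k ≠ i + 1) :
    gen m (i + 1) * loop m k = loop m k * gen m (i + 1) := by
  change Commute _ _
  rcases lt_or_gt_of_ne hk with h | h
  · have h1 : Commute (gen m (i + 1)) (cycle m k) := gen_mul_cycle_of_lt (by omega)
    have h2 : Commute (gen m (i + 1)) (gen m k) := (gen_comm m (by omega)).symm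
    exact (h1.inv_right.mul_right (h2.pow_right 2)).mul_right h1
  · have h1 : SemiconjBy (cycle m k) (gen m (i + 1)) (gen m i) :=
      (gen_mul_cycle_of_gt hi (by omega)).symm
    have h2 : Commute (gen m k) (gen m i) := (gen_comm m (by omega)).symm
    have h3 : SemiconjBy (loop m k) (gen m (i + 1)) (gen m (i + 1)) :=
      (h1.inv_symm_left.mul_left (h2.pow_left 2)).mul_left h1
    exact h3.symm

theorem gen_mul_loop_self {m i : ℕ} (hi : i + 1 < m) :
    gen m (i + 1) * loop m i = loop m (i + 1) * gen m (i + 1) := by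
  have h1 : Commute (gen m (i + 1)) (cycle m i) := gen_mul_cycle_of_lt (by omega)
  have h2 : gen m (i + 1) * gen m i ^ 2 =
      (gen m i)⁻¹ * gen m (i + 1) ^ 2 * gen m i * gen m (i + 1) := by
    have h := gen_braid hi
    generalize gen m i = a at h ⊢
    generalize gen m (i + 1) = b at h ⊢
    rw [mul_assoc, mul_assoc, eq_inv_mul_iff_mul_eq]
    calc a * (b * a ^ 2) = a * b * a * a := by simp only [pow_two, mul_assoc]
      _ = b * a * b * a := by rw [h]
      _ = b * (a * b * a) := by simp only [mul_assoc]
      _ = b ^ 2 * a * b := by rw [h]; simp only [pow_two, mul_assoc]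
      _ = b ^ 2 * (a * b) := mul_assoc _ _ _
  calc gen m (i + 1) * loop m i
      = (cycle m i)⁻¹ * (gen m (i + 1) * gen m i ^ 2) * cycle m i := by
        rw [loop, ← mul_assoc, ← mul_assoc, h1.inv_right.eq]; simp only [mul_assoc]
    _ = loop m (i + 1) * gen m (i + 1) := by
        rw [h2, loop, cycle, mul_assoc, mul_assoc, h1.eq]; simp only [mul_assoc, mul_inv_rev]

theorem gen_mul_loop_mul_loop {m i : ℕ} (hi : i + 1 < m) :
    gen m (i + 1) * (loop m i * loop m (i + 1)) = loop m i * loop m (i + 1) * gen m (i + 1) := by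
  have h1 : Commute (gen m (i + 1)) (cycle m i) := gen_mul_cycle_of_lt (by omega)
  have h2 : loop m i * loop m (i + 1) =
      (cycle m i)⁻¹ * (gen m i * gen m (i + 1) ^ 2 * gen m i) * cycle m i := by
    rw [loop, loop, cycle]; simp only [mul_assoc, mul_inv_rev, pow_two, mul_inv_cancel_left]
  have h3 : Commute (gen m (i + 1)) (gen m i * gen m (i + 1) ^ 2 * gen m i) := by
    have h := gen_braid hi
    generalize gen m i = a at h ⊢
    generalize gen m (i + 1) = b at h ⊢
    calc b * (a * b ^ 2 * a) = b * a * b * (b * a) := by simp only [pow_two, mul_assoc]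
      _ = a * b * (a * b * a) := by rw [← h]; simp only [mul_assoc]
      _ = a * b ^ 2 * a * b := by rw [h]; simp only [pow_two, mul_assoc]
  rw [h2]
  exact (h1.inv_right.mul_right h3).mul_right h1

/-- The free factor of `Split m` inside the braid group. -/
def loopHom (m : ℕ) : FreeGroup ℕ →* BraidGroup (m + 2) := FreeGroup.lift (loop (m + 1))

/-- The embedding of the braid factor of `Split m`, which leaves the first strand alone. -/
def shift (m : ℕ) : BraidGroup (m + 1) →* BraidGroup (m + 2) :=
  lift (fun i => gen (m + 1) (i + 1)) (fun _ _ h _ => gen_comm _ (by omega))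
    fun _ h => gen_braid (by omega)

theorem shift_gen {m i : ℕ} (h : i < m) : shift m (gen m i) = gen (m + 1) (i + 1) :=
  lift_gen _ _ _ h

theorem loopHom_of (m k : ℕ) : loopHom m (FreeGroup.of k) = loop (m + 1) k := by
  simp [loopHom]

theorem gen_mul_loopHom {m i : ℕ} (h : i < m) (g : FreeGroup ℕ) :
    loopHom m (artin i g) = gen (m + 1) (i + 1) * loopHom m g * (gen (m + 1) (i + 1))⁻¹ := by
  have key : (loopHom m).comp (artin i).toMonoidHom =
      (MulAut.conj (gen (m + 1) (i + 1))).toMonoidHom.comp (loopHom m) := by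
    refine FreeGroup.ext_hom _ _ fun k => ?_
    have h1 := gen_mul_loop_self (show i + 1 < m + 1 by omega)
    simp only [MonoidHom.comp_apply, MulEquiv.coe_toMonoidHom, MulAut.conj_apply, loopHom_of]
    rw [eq_mul_inv_iff_mul_eq]
    by_cases hk : k = i
    · rw [hk, FreeGroup.artin_of_self, loopHom_of, h1]
    by_cases hk' : k = i + 1
    · have h2 := gen_mul_loop_mul_loop (show i + 1 < m + 1 by omega)
      rw [hk', FreeGroup.artin_of_succ, map_mul, map_mul, map_inv, loopHom_of, loopHom_of,
        mul_assoc, mul_assoc, inv_mul_eq_iff_eq_mul, ← mul_assoc, ← h2, ← mul_assoc, ← mul_assoc,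
        h1]
    · rw [FreeGroup.artin_of_of_ne hk hk', loopHom_of,
        gen_mul_loop_of_ne (show i + 1 < m + 1 by omega) hk hk']
  exact DFunLike.congr_fun key g

theorem loopHom_action {m : ℕ} (b : BraidGroup (m + 1)) (g : FreeGroup ℕ) :
    loopHom m (action m b g) = shift m b * loopHom m g * (shift m b)⁻¹ := by
  induction b using induction with
  | one => simp
  | gen_mul i h b ih =>
    rw [map_mul, MulAut.mul_apply, action_gen h, gen_mul_loopHom h, ih, map_mul, shift_gen h]
    simp only [mul_assoc, mul_inv_rev]
  | inv_mul i h b ih =>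
    have := gen_mul_loopHom h ((artin i).symm (action m b g))
    rw [MulEquiv.apply_symm_apply, ih] at this
    rw [map_mul, MulAut.mul_apply, map_inv, MulAut.inv_apply, action_gen h, map_mul, map_inv,
      shift_gen h, mul_inv_rev, inv_inv, mul_assoc, mul_assoc, eq_inv_mul_iff_mul_eq, ← mul_assoc,
      ← mul_assoc, ← mul_inv_eq_iff_eq_mul]
    simpa only [mul_assoc] using this.symm

namespace Split

/-- The homomorphism realizing `Split m` as a group of braids that fix the first strand. -/
def toBraid (m : ℕ) : Split m →* BraidGroup (m + 2) :=
  SemidirectProduct.lift (loopHom m) (shift m) fun b =>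
    MonoidHom.ext fun g => loopHom_action b g

theorem toBraid_s {m i : ℕ} (h : i < m) : toBraid m (s m i) = gen (m + 1) (i + 1) := by
  rw [toBraid, s, SemidirectProduct.lift_inr, shift_gen h]

theorem toBraid_x (m i : ℕ) : toBraid m (x m i) = loop (m + 1) i := by
  rw [toBraid, x, SemidirectProduct.lift_inl, loopHom_of]

/-- The braid encoded by a labelled strand. -/
def eval (p : ℕ × Split m) : BraidGroup (m + 2) := cycle (m + 1) p.1 * toBraid m p.2

theorem eval_step {i : ℕ} (h : i < m + 1) {p : ℕ × Split m} (hp : p.1 ≤ m + 1) :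
    eval (step m i p) = gen (m + 1) i * eval p := by
  obtain ⟨j, g⟩ := p
  rcases lt_trichotomy j i with hj | rfl | hj
  · obtain ⟨i, rfl⟩ := Nat.exists_eq_succ_of_ne_zero (show i ≠ 0 by omega)
    simp only [Nat.succ_eq_add_one]
    rw [step_succ_apply_of_le h (by omega), eval, eval, map_mul, toBraid_s (by omega), ← mul_assoc,
      ← mul_assoc, gen_mul_cycle_of_lt hj]
  · rw [step_apply_self h, eval, eval, cycle, mul_assoc]
  rcases (Nat.succ_le_of_lt hj).eq_or_lt with rfl | hj
  · rw [Nat.succ_eq_add_one, step_apply_succ h, eval, eval, map_mul, toBraid_x, loop, cycle]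
    simp only [pow_two, mul_assoc, mul_inv_cancel_left]
  · have : j ≤ m + 1 := hp
    rw [step_apply_of_gt hj hp, eval, eval, map_mul, toBraid_s (by omega), ← mul_assoc,
      ← mul_assoc, gen_mul_cycle_of_gt (by omega) hj]

theorem step_fst_le {i : ℕ} (h : i < m + 1) {p : ℕ × Split m} :
    (step m i p).1 ≤ m + 1 ↔ p.1 ≤ m + 1 := by
  change Equiv.swap i (i + 1) p.1 ≤ m + 1 ↔ _
  rw [Equiv.swap_apply_def]
  split_ifs <;> omega

end Split

theorem eval_strands {m : ℕ} (b : BraidGroup (m + 2)) {p : ℕ × Split m} (hp : p.1 ≤ m + 1) :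
    (strands m b p).1 ≤ m + 1 ∧ eval (strands m b p) = b * eval p := by
  induction b using induction (m := m + 1) with
  | one => simpa using hp
  | gen_mul i h b ih =>
    rw [map_mul, Equiv.Perm.mul_apply, strands_gen h, step_fst_le h, eval_step h ih.1, ih.2,
      mul_assoc]
    exact ⟨ih.1, rfl⟩
  | inv_mul i h b ih =>
    obtain ⟨q, hq⟩ := (step m i).surjective (strands m b p)
    have h1 : q.1 ≤ m + 1 := (step_fst_le h).1 (hq ▸ ih.1)
    have h2 : strands m ((gen (m + 1) i)⁻¹ * b) p = q := by
      rw [map_mul, Equiv.Perm.mul_apply, map_inv, strands_gen h, Equiv.Perm.inv_eq_iff_eq, hq]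
    rw [h2, mul_assoc, ← ih.2, ← hq, eval_step h h1, inv_mul_cancel_left]
    exact ⟨h1, rfl⟩

/-- The group of braids that fix the first strand. -/
def firstStrand (m : ℕ) : Subgroup (BraidGroup (m + 2)) where
  carrier := {b | (strands m b (0, 1)).1 = 0}
  one_mem' := by simp
  mul_mem' {a b} ha hb := by
    simp only [Set.mem_ofPred_eq] at *
    have h := strands_apply_mul a 0 1 (strands m b (0, 1)).2
    rw [one_mul] at h
    rw [map_mul, Equiv.Perm.mul_apply, ← Prod.mk.eta (p := strands m b (0, 1)), hb, h, ha]
  inv_mem' {a} ha := by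
    simp only [Set.mem_ofPred_eq] at *
    have h := strands_apply_mul a 0 1 (strands m a (0, 1)).2⁻¹
    rw [one_mul, ha, mul_inv_cancel] at h
    rw [map_inv, Equiv.Perm.inv_eq_iff_eq.2 h.symm]

/-- The label of the first strand of a braid that fixes it. -/
def firstLabel (m : ℕ) : firstStrand m →* Split m where
  toFun b := (strands m b (0, 1)).2
  map_one' := by simp
  map_mul' a b := by
    have hb : (strands m b (0, 1)).1 = 0 := b.2
    have h := strands_apply_mul (a : BraidGroup (m + 2)) 0 1 (strands m b (0, 1)).2
    rw [one_mul] at h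
    rw [Subgroup.coe_mul, map_mul, Equiv.Perm.mul_apply, ← Prod.mk.eta (p := strands m b (0, 1)),
      hb, h]

theorem toBraid_firstLabel {m : ℕ} (b : firstStrand m) : toBraid m (firstLabel m b) = b := by
  have hb : (strands m b (0, 1)).1 = 0 := b.2
  have := (eval_strands (b : BraidGroup (m + 2)) (p := (0, 1)) (Nat.zero_le _)).2
  simpa [eval, hb, cycle, firstLabel] using this

theorem isConj_action {m : ℕ} (b : BraidGroup (m + 2)) (j : ℕ) (g : Split m) :
    IsConj (FreeGroup.of (strands m b (j, g)).1) (action (m + 1) b (FreeGroup.of j)) := by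
  have key : ∀ (i : ℕ) (p : ℕ × Split m),
      IsConj (FreeGroup.of (step m i p).1) (artin i (FreeGroup.of p.1)) := by
    rintro i ⟨j, g⟩
    by_cases hj : j = i
    · subst hj
      rw [step_apply, Equiv.swap_apply_left, FreeGroup.artin_of_self]
    by_cases hj' : j = i + 1
    · subst hj'
      rw [step_apply, Equiv.swap_apply_right, FreeGroup.artin_of_succ]
      exact isConj_iff.2 ⟨(FreeGroup.of (i + 1))⁻¹, by rw [inv_inv]⟩
    · rw [step_apply, Equiv.swap_apply_of_ne_of_ne hj hj', FreeGroup.artin_of_of_ne hj hj']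
  induction b using induction (m := m + 1) with
  | one => rw [map_one, map_one, Equiv.Perm.one_apply, MulAut.one_apply]
  | gen_mul i h b ih =>
    rw [map_mul, Equiv.Perm.mul_apply, strands_gen h, map_mul, MulAut.mul_apply, action_gen h]
    exact (key i _).trans ((artin i).toMonoidHom.map_isConj ih)
  | inv_mul i h b ih =>
    obtain ⟨q, hq⟩ := (step m i).surjective (strands m b (j, g))
    rw [map_mul, Equiv.Perm.mul_apply, map_inv, strands_gen h, Equiv.Perm.inv_eq_iff_eq.2 hq.symm,
      map_mul, MulAut.mul_apply, map_inv, action_gen h, MulAut.inv_apply]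
    have := (artin i).symm.toMonoidHom.map_isConj ((key i q).symm.trans (hq ▸ ih))
    simpa using this

theorem mem_firstStrand {m : ℕ} {b : BraidGroup (m + 2)}
    (h : action (m + 1) b (FreeGroup.of 0) = FreeGroup.of 0) : b ∈ firstStrand m := by
  have h1 := isConj_action b 0 1
  rw [h] at h1
  let f : FreeGroup ℕ →* Multiplicative ℤ :=
    FreeGroup.lift fun j => if j = 0 then Multiplicative.ofAdd 1 else 1
  have h2 := isConj_iff_eq.1 (f.map_isConj h1)
  change (strands m b (0, 1)).1 = 0
  by_contra hne
  simp only [f, FreeGroup.lift_apply_of, if_neg hne, if_pos] at h2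
  exact absurd (congrArg Multiplicative.toAdd h2) zero_ne_one

theorem isLeftOrderable (m : ℕ) : IsLeftOrderable (BraidGroup (m + 1)) := by
  induction m with
  | zero =>
    exact ⟨fun _ => False, by simp, by simp, fun a ha => (ha (by
      induction a using induction (m := 0) with
      | one => rfl
      | gen_mul i h => omega
      | inv_mul i h => omega)).elim⟩
  | succ m ih =>
    refine .of_stabilizer (action (m + 1)) (fun g => 0 < g.weight)
      (fun _ _ => FreeGroup.weight_mul_pos) (by simp [FreeGroup.weight_one])
      (fun _ => FreeGroup.weight_pos_or_weight_inv_pos) (fun b g h => by rwa [weight_action])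
      (FreeGroup.of 0) (firstStrand m) ?_ fun _ => mem_firstStrand
    exact (FreeGroup.isLeftOrderable.semidirectProduct ih (action m)).of_injective (firstLabel m)
      fun a b hab => Subtype.ext (by rw [← toBraid_firstLabel, hab, toBraid_firstLabel])

end BraidGroup

/-- (Dehornoy) The braid group `Bₙ` admits a left-invariant strict linear order:
there is a strict total order `<` such that `f < g` implies `h·f < h·g`. -/
theorem braidGroup_leftOrderable (n : ℕ) (hn : 1 ≤ n) :
    ∃ r : BraidGroup n → BraidGroup n → Prop,
      IsStrictTotalOrder (BraidGroup n) r ∧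
      ∀ f g h : BraidGroup n, r f g → r (h * f) (h * g) := by
  obtain ⟨m, rfl⟩ := Nat.exists_eq_add_of_le' hn
  exact (BraidGroup.isLeftOrderable m).exists_isStrictTotalOrder
end

section
/- (Bigelow) The reduced Burau representation of the braid group B_5 is a well-defined group homomorphism ρ̄ : B_5 → GL_4(ℤ[t, t⁻¹]) (the matrices ρ̄(σ_i) are invertible over ℤ[t, t⁻¹] and satisfy the braid relations), and it is not injective: there exists w ∈ B_5 with w ≠ 1 and ρ̄(w) equal to the 4 × 4 identity matrix. -/
open LaurentPolynomial in
/-- The matrix of the generator `σ_{i+1}` (Lean index `i : Fin (n-1)`) under the reduced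
Burau representation: it agrees with the identity matrix except in column `i`, whose
entries are `-t` in row `i-1`, `-t` in row `i`, `-1` in row `i+1`, and `0` elsewhere. -/
noncomputable def burauMat (n : ℕ) (i : Fin (n - 1)) :
    Matrix (Fin (n - 1)) (Fin (n - 1)) (LaurentPolynomial ℤ) := fun r c =>
  if c = i then
    (if (r : ℕ) + 1 = (i : ℕ) then -T 1
     else if r = i then -T 1
     else if (r : ℕ) = (i : ℕ) + 1 then -1
     else 0)
  else if r = c then 1 else 0

/-- The Hurwitz action of the Artin generators of `B₅` on quintuples of elements of a group. -/
def hurwitz (G : Type*) [Group G] : Fin 4 → Equiv.Perm (G × G × G × G × G)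
  | 0 => ⟨fun (a, b, c, d, e) => (b, b⁻¹ * a * b, c, d, e),
      fun (a, b, c, d, e) => (a * b * a⁻¹, a, c, d, e),
      fun _ => by simp [mul_assoc], fun _ => by simp [mul_assoc]⟩
  | 1 => ⟨fun (a, b, c, d, e) => (a, c, c⁻¹ * b * c, d, e),
      fun (a, b, c, d, e) => (a, b * c * b⁻¹, b, d, e),
      fun _ => by simp [mul_assoc], fun _ => by simp [mul_assoc]⟩
  | 2 => ⟨fun (a, b, c, d, e) => (a, b, d, d⁻¹ * c * d, e),
      fun (a, b, c, d, e) => (a, b, c * d * c⁻¹, c, e),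
      fun _ => by simp [mul_assoc], fun _ => by simp [mul_assoc]⟩
  | 3 => ⟨fun (a, b, c, d, e) => (a, b, c, e, e⁻¹ * d * e),
      fun (a, b, c, d, e) => (a, b, c, d * e * d⁻¹, d),
      fun _ => by simp [mul_assoc], fun _ => by simp [mul_assoc]⟩

/-- Elements of a group satisfying Artin's relations define a homomorphism out of `B₅`. -/
theorem exists_braidGroup_five_hom {H : Type*} [Group H] (s : Fin 4 → H)
    (h02 : s 0 * s 2 = s 2 * s 0) (h03 : s 0 * s 3 = s 3 * s 0) (h13 : s 1 * s 3 = s 3 * s 1)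
    (h01 : s 0 * s 1 * s 0 = s 1 * s 0 * s 1) (h12 : s 1 * s 2 * s 1 = s 2 * s 1 * s 2)
    (h23 : s 2 * s 3 * s 2 = s 3 * s 2 * s 3) :
    ∃ φ : BraidGroup 5 →* H, ∀ i : Fin 4, φ (PresentedGroup.of i) = s i := by
  refine ⟨PresentedGroup.toGroup (f := s) ?_, fun i => PresentedGroup.toGroup.of _⟩
  rintro _ (⟨i, k, hik, rfl⟩ | ⟨i, k, hik, rfl⟩) <;>
    simp only [map_mul, map_inv, FreeGroup.lift_apply_of, mul_inv_eq_one] <;>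
    change Fin 4 at i k <;> fin_cases i <;> fin_cases k <;> simp at hik <;> assumption

theorem exists_hurwitz_hom (G : Type*) [Group G] :
    ∃ φ : BraidGroup 5 →* Equiv.Perm (G × G × G × G × G),
      ∀ i : Fin 4, φ (PresentedGroup.of i) = hurwitz G i := by
  apply exists_braidGroup_five_hom <;> ext1 x <;> simp [hurwitz, mul_assoc]

section Words

variable {H K : Type*} [Group H] [Group K]

/-- The first conjugating braid in Bigelow's commutator, as a word in the generators `s`. -/
def bigelowLeft (s : Fin 4 → H) : H :=
  (s 2)⁻¹ * (s 1 * s 0 ^ 2 * s 1 * s 3 ^ 3 * s 2 * s 1)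

/-- The second conjugating braid in Bigelow's commutator, as a word in the generators `s`. -/
def bigelowRight (s : Fin 4 → H) : H :=
  (s 3)⁻¹ * (s 2 * s 1) * (s 0 ^ 2)⁻¹ * (s 1 * s 0 ^ 2 * s 1 ^ 2 * s 0 * s 3 ^ 5)

/-- The pure braid moving the last strand once around all the others. -/
def lastStrandLoop (s : Fin 4 → H) : H :=
  s 3 * s 2 * s 1 * s 0 ^ 2 * s 1 * s 2 * s 3

/-- A conjugate of `lastStrandLoop`, whose image under the Burau representation commutes with that
of the last generator. -/
def bigelowConj (s : Fin 4 → H) : H :=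
  (bigelowRight s * (bigelowLeft s)⁻¹)⁻¹ * lastStrandLoop s *
    (bigelowRight s * (bigelowLeft s)⁻¹)

theorem map_bigelowConj (φ : H →* K) (s : Fin 4 → H) :
    φ (bigelowConj s) = bigelowConj fun i => φ (s i) := by
  simp [bigelowConj, bigelowLeft, bigelowRight, lastStrandLoop]

end Words

open DihedralGroup in
theorem not_commute_hurwitz_bigelowConj :
    ¬ Commute (hurwitz (DihedralGroup 3) 3) (bigelowConj (hurwitz (DihedralGroup 3))) := by
  intro h
  set s := hurwitz (DihedralGroup 3)
  have h₁ : bigelowLeft s (r 0, sr 2, sr 0, sr 0, sr 0) = (r 0, sr 0, sr 1, sr 0, sr 0) := by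
    decide +kernel
  have h₂ : bigelowRight s (r 0, sr 2, sr 0, sr 0, sr 0) = (sr 0, r 0, sr 0, sr 1, sr 2) := by
    decide +kernel
  have h₃ : lastStrandLoop s (sr 0, r 0, sr 0, sr 1, sr 2) = (sr 1, r 0, sr 1, sr 0, sr 1) := by
    decide +kernel
  have h₄ : bigelowRight s (r 0, sr 1, sr 1, sr 2, sr 0) = (sr 1, r 0, sr 1, sr 0, sr 1) := by
    decide +kernel
  have h₅ : bigelowLeft s (r 0, sr 1, sr 1, sr 2, sr 0) = (r 0, sr 0, sr 2, sr 1, sr 0) := by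
    decide +kernel
  have hconj : bigelowConj s (r 0, sr 0, sr 1, sr 0, sr 0) = (r 0, sr 0, sr 2, sr 1, sr 0) := by
    rw [← Equiv.Perm.eq_inv_iff_eq] at h₁ h₄
    simp only [bigelowConj, mul_inv_rev, inv_inv, Equiv.Perm.mul_apply, ← h₁, h₂, h₃, ← h₄, h₅]
  have hfix : s 3 (r 0, sr 0, sr 1, sr 0, sr 0) = (r 0, sr 0, sr 1, sr 0, sr 0) := by
    decide +kernel
  have := DFunLike.congr_fun h.eq (r 0, sr 0, sr 1, sr 0, sr 0)
  rw [Equiv.Perm.mul_apply, Equiv.Perm.mul_apply, hfix, hconj] at this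
  revert this
  decide +kernel

section Burau

open Matrix

theorem vec4_eta {R : Type*} (x : Fin 4 → R) : ![x 0, x 1, x 2, x 3] = x := by
  ext i; fin_cases i <;> rfl

variable {R : Type*} [CommRing R]

/-- The reduced Burau matrices of the generators of `B₅`, at a unit `t` of a commutative ring. -/
def burauGL (t : Rˣ) : Fin 4 → GL (Fin 4) R
  | 0 => ⟨!![-t, 0, 0, 0; -1, 1, 0, 0; 0, 0, 1, 0; 0, 0, 0, 1],
      !![-↑t⁻¹, 0, 0, 0; -↑t⁻¹, 1, 0, 0; 0, 0, 1, 0; 0, 0, 0, 1],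
      by ext i j; fin_cases i <;> fin_cases j <;> simp [mul_apply, Fin.sum_univ_four],
      by ext i j; fin_cases i <;> fin_cases j <;> simp [mul_apply, Fin.sum_univ_four]⟩
  | 1 => ⟨!![1, -t, 0, 0; 0, -t, 0, 0; 0, -1, 1, 0; 0, 0, 0, 1],
      !![1, -1, 0, 0; 0, -↑t⁻¹, 0, 0; 0, -↑t⁻¹, 1, 0; 0, 0, 0, 1],
      by ext i j; fin_cases i <;> fin_cases j <;> simp [mul_apply, Fin.sum_univ_four],
      by ext i j; fin_cases i <;> fin_cases j <;> simp [mul_apply, Fin.sum_univ_four]⟩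
  | 2 => ⟨!![1, 0, 0, 0; 0, 1, -t, 0; 0, 0, -t, 0; 0, 0, -1, 1],
      !![1, 0, 0, 0; 0, 1, -1, 0; 0, 0, -↑t⁻¹, 0; 0, 0, -↑t⁻¹, 1],
      by ext i j; fin_cases i <;> fin_cases j <;> simp [mul_apply, Fin.sum_univ_four],
      by ext i j; fin_cases i <;> fin_cases j <;> simp [mul_apply, Fin.sum_univ_four]⟩
  | 3 => ⟨!![1, 0, 0, 0; 0, 1, 0, 0; 0, 0, 1, -t; 0, 0, 0, -t],
      !![1, 0, 0, 0; 0, 1, 0, 0; 0, 0, 1, -1; 0, 0, 0, -↑t⁻¹],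
      by ext i j; fin_cases i <;> fin_cases j <;> simp [mul_apply, Fin.sum_univ_four],
      by ext i j; fin_cases i <;> fin_cases j <;> simp [mul_apply, Fin.sum_univ_four]⟩

variable (t : Rˣ) (a b c d : R)

theorem burauGL_zero_mulVec :
    (burauGL t 0).val *ᵥ ![a, b, c, d] = ![-t * a, b - a, c, d] := by
  ext i; fin_cases i <;> simp [burauGL, mulVec, dotProduct, Fin.sum_univ_four]; ring

theorem burauGL_one_mulVec :
    (burauGL t 1).val *ᵥ ![a, b, c, d] = ![a - t * b, -t * b, c - b, d] := by
  ext i; fin_cases i <;> simp [burauGL, mulVec, dotProduct, Fin.sum_univ_four] <;> ring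

theorem burauGL_two_mulVec :
    (burauGL t 2).val *ᵥ ![a, b, c, d] = ![a, b - t * c, -t * c, d - c] := by
  ext i; fin_cases i <;> simp [burauGL, mulVec, dotProduct, Fin.sum_univ_four] <;> ring

theorem burauGL_three_mulVec :
    (burauGL t 3).val *ᵥ ![a, b, c, d] = ![a, b, c - t * d, -t * d] := by
  ext i; fin_cases i <;> simp [burauGL, mulVec, dotProduct, Fin.sum_univ_four]; ring

theorem exists_burau_hom :
    ∃ ρ : BraidGroup 5 →* GL (Fin 4) R,
      ∀ i : Fin 4, ρ (PresentedGroup.of i) = burauGL t i := by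
  apply exists_braidGroup_five_hom <;> refine Units.ext (mulVec_injective (funext fun x => ?_)) <;>
    rw [← vec4_eta x] <;>
    simp only [Units.val_mul, ← mulVec_mulVec, burauGL_zero_mulVec, burauGL_one_mulVec,
      burauGL_two_mulVec, burauGL_three_mulVec] <;>
    ext i <;> fin_cases i <;> simp <;> ring

theorem vecMul_burauGL_zero :
    ![a, b, c, d] ᵥ* (burauGL t 0).val = ![-t * a - b, b, c, d] := by
  ext i; fin_cases i <;> simp [burauGL, vecMul, dotProduct, Fin.sum_univ_four]; ring

theorem vecMul_burauGL_one :
    ![a, b, c, d] ᵥ* (burauGL t 1).val = ![a, -t * a - t * b - c, c, d] := by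
  ext i; fin_cases i <;> simp [burauGL, vecMul, dotProduct, Fin.sum_univ_four]; ring

theorem vecMul_burauGL_two :
    ![a, b, c, d] ᵥ* (burauGL t 2).val = ![a, b, -t * b - t * c - d, d] := by
  ext i; fin_cases i <;> simp [burauGL, vecMul, dotProduct, Fin.sum_univ_four]; ring

theorem vecMul_burauGL_three :
    ![a, b, c, d] ᵥ* (burauGL t 3).val = ![a, b, c, -t * c - t * d] := by
  ext i; fin_cases i <;> simp [burauGL, vecMul, dotProduct, Fin.sum_univ_four]; ring

theorem GL.inv_mulVec_eq {n : Type*} [Fintype n] [DecidableEq n] {g : GL n R} {x y : n → R}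
    (h : g.val *ᵥ y = x) : (g⁻¹).val *ᵥ x = y := by
  rw [← h, mulVec_mulVec, ← Units.val_mul, inv_mul_cancel, Units.val_one, one_mulVec]

theorem GL.vecMul_inv_eq {n : Type*} [Fintype n] [DecidableEq n] {g : GL n R} {x y : n → R}
    (h : y ᵥ* g.val = x) : x ᵥ* (g⁻¹).val = y := by
  rw [← h, vecMul_vecMul, ← Units.val_mul, mul_inv_cancel, Units.val_one, vecMul_one]

/-- If `S - 1` and `D - t` have rank one, then `S` commutes with `Y⁻¹ * D * Y` as soon as two
scalars vanish. -/
theorem GL.commute_conj_of_rank_one {n : Type*} [Fintype n] [DecidableEq n] {S D Y : GL n R}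
    {t : R} {u v e r : n → R} (hS : S.val = 1 + vecMulVec u v)
    (hD : D.val = t • 1 + vecMulVec e r) (hr : r ⬝ᵥ Y.val *ᵥ u = 0)
    (hv : v ⬝ᵥ (Y⁻¹).val *ᵥ e = 0) : Commute S (Y⁻¹ * D * Y) := by
  have hC : (Y⁻¹ * D * Y).val = t • 1 + vecMulVec ((Y⁻¹).val *ᵥ e) (r ᵥ* Y.val) := by
    rw [Units.val_mul, Units.val_mul, hD, mul_add, add_mul, mul_vecMulVec, vecMulVec_mul]
    simp
  rw [dotProduct_mulVec] at hr
  refine Units.ext ?_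
  rw [Units.val_mul S, Units.val_mul _ S, hC, hS]
  simp only [add_mul, mul_add, vecMulVec_mul_vecMulVec, hr, hv, one_mul, mul_one, zero_smul,
    smul_mul_assoc, mul_smul_comm, vecMulVec_zero, smul_add, add_zero]
  abel

theorem burauGL_three_val :
    (burauGL t 3).val = 1 + vecMulVec ![0, 0, -(t : R), -t - 1] ![0, 0, 0, 1] := by
  ext i j; fin_cases i <;> fin_cases j <;> simp [burauGL]

theorem lastStrandLoop_burauGL_val :
    (lastStrandLoop (burauGL t)).val = (t : R) • 1 + vecMulVec ![0, 0, 0, 1]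
      ![(t : R) - t ^ 2, -t + t ^ 3, t - t ^ 4, -t + t ^ 5] := by
  have key : ∀ x : Fin 4 → R, (lastStrandLoop (burauGL t)).val *ᵥ x = ((t : R) • 1 +
      vecMulVec ![0, 0, 0, 1] ![(t : R) - t ^ 2, -t + t ^ 3, t - t ^ 4, -t + t ^ 5]) *ᵥ x := by
    intro x
    rw [← vec4_eta x]
    simp only [lastStrandLoop, pow_two, Units.val_mul, ← mulVec_mulVec, burauGL_zero_mulVec,
      burauGL_one_mulVec, burauGL_two_mulVec, burauGL_three_mulVec, add_mulVec, smul_mulVec,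
      one_mulVec, vecMulVec_mulVec]
    ext i; fin_cases i <;> simp [dotProduct, Fin.sum_univ_four] <;> ring
  exact mulVec_injective (funext key)

theorem bigelowLeft_inv_burauGL_mulVec :
    (t : R) ^ 3 • (((bigelowLeft (burauGL t))⁻¹).val *ᵥ ![0, 0, -(t : R), -t - 1]) =
      ![(t : R) - t ^ 2 + t ^ 3 - t ^ 4 + t ^ 5, 1 - t + t ^ 2 - t ^ 3 + t ^ 4, -t,
        -t ^ 2 + t ^ 3 - t ^ 4] := by
  rw [← mulVec_smul]
  apply GL.inv_mulVec_eq
  rw [bigelowLeft, Units.val_mul, ← mulVec_mulVec]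
  apply GL.inv_mulVec_eq
  simp only [smul_cons, smul_eq_mul, smul_empty, pow_succ (burauGL t _), pow_zero, one_mul,
    Units.val_mul, ← mulVec_mulVec, burauGL_zero_mulVec,
    burauGL_one_mulVec, burauGL_two_mulVec, burauGL_three_mulVec]
  ext i; fin_cases i <;> simp <;> ring

theorem vecMul_bigelowLeft_burauGL :
    (t : R) • (![0, 0, 0, 1] ᵥ* (bigelowLeft (burauGL t)).val) =
      ![-1 + (t : R), t - 2 * t ^ 2 + t ^ 3 - t ^ 4, -t + t ^ 2 + t ^ 4,
        t - t ^ 2 + t ^ 3 - t ^ 4] := by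
  have h : ((t : R) • ![0, 0, 0, 1]) ᵥ* ((burauGL t 2)⁻¹).val = ![0, 0, -1, (t : R)] := by
    apply GL.vecMul_inv_eq
    rw [vecMul_burauGL_two]
    simp
  rw [← smul_vecMul, bigelowLeft, Units.val_mul, ← vecMul_vecMul, h]
  simp only [pow_succ (burauGL t _), pow_zero, one_mul,
    Units.val_mul, ← vecMul_vecMul, vecMul_burauGL_zero,
    vecMul_burauGL_one, vecMul_burauGL_two, vecMul_burauGL_three]
  ext i; fin_cases i <;> simp <;> ring

theorem bigelowRight_inv_burauGL_mulVec :
    (t : R) ^ 5 • (((bigelowRight (burauGL t))⁻¹).val *ᵥ ![0, 0, 0, 1]) =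
      (![-t + t ^ 2 - t ^ 3 + t ^ 4 - t ^ 5 + t ^ 6, t ^ 6, t ^ 4 - t ^ 5 + t ^ 6,
        -1 + t] : Fin 4 → R) := by
  have h : ((burauGL t 0 ^ 2)⁻¹).val *ᵥ
      (![-t ^ 8, -t ^ 5 + t ^ 6 - t ^ 7, 0, t ^ 5 - t ^ 6] : Fin 4 → R) =
        (![-t ^ 6, -t ^ 5, 0, t ^ 5 - t ^ 6] : Fin 4 → R) := by
    apply GL.inv_mulVec_eq
    simp only [pow_two (burauGL t _), Units.val_mul, ← mulVec_mulVec, burauGL_zero_mulVec]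
    ext i; fin_cases i <;> simp <;> ring
  rw [← mulVec_smul]
  apply GL.inv_mulVec_eq
  rw [bigelowRight, mul_assoc, mul_assoc, Units.val_mul, ← mulVec_mulVec]
  apply GL.inv_mulVec_eq
  have h' : (burauGL t 1 * burauGL t 0 ^ 2 * burauGL t 1 ^ 2 * burauGL t 0 *
      burauGL t 3 ^ 5).val *ᵥ (![-t + t ^ 2 - t ^ 3 + t ^ 4 - t ^ 5 + t ^ 6, t ^ 6,
        t ^ 4 - t ^ 5 + t ^ 6, -1 + t] : Fin 4 → R) =
          (![-t ^ 8, -t ^ 5 + t ^ 6 - t ^ 7, 0, t ^ 5 - t ^ 6] : Fin 4 → R) := by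
    simp only [pow_succ (burauGL t _), pow_zero, one_mul, Units.val_mul, ← mulVec_mulVec,
      burauGL_zero_mulVec, burauGL_one_mulVec, burauGL_three_mulVec]
    ext i; fin_cases i <;> simp <;> ring
  rw [Units.val_mul, Units.val_mul (_⁻¹), ← mulVec_mulVec, ← mulVec_mulVec, h', h]
  simp only [smul_cons, smul_eq_mul, smul_empty, Units.val_mul, ← mulVec_mulVec,
    burauGL_one_mulVec, burauGL_two_mulVec, burauGL_three_mulVec]
  ext i; fin_cases i <;> simp <;> ring

theorem vecMul_bigelowRight_burauGL :
    (![t - t ^ 2, -t + t ^ 3, t - t ^ 4, -t + t ^ 5] : Fin 4 → R) ᵥ*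
        (bigelowRight (burauGL t)).val =
      (![-1 + 2 * t - t ^ 2 - t ^ 3 + t ^ 4 + t ^ 5 - t ^ 6 + t ^ 8 - t ^ 9,
        -2 * t ^ 2 + 3 * t ^ 3 - t ^ 4 - t ^ 6 + 2 * t ^ 7 - 2 * t ^ 8 + t ^ 9,
        -1 + t - t ^ 4 + t ^ 5,
        t - 2 * t ^ 2 + 2 * t ^ 3 - 2 * t ^ 4 + 2 * t ^ 5 - 2 * t ^ 6 + 2 * t ^ 7 - 2 * t ^ 8
          + 2 * t ^ 9 - t ^ 10] : Fin 4 → R) := by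
  have h : (![t - t ^ 2, -t + t ^ 3, t - t ^ 4, -t + t ^ 5] : Fin 4 → R) ᵥ*
      ((burauGL t 3)⁻¹).val =
      (![t - t ^ 2, -t + t ^ 3, t - t ^ 4, 1 - t] : Fin 4 → R) := by
    apply GL.vecMul_inv_eq
    rw [vecMul_burauGL_three]
    ext i; fin_cases i <;> simp; ring
  have h' : ((t : R) ^ 2 • (![t - t ^ 2, 1 - t + t ^ 3 - t ^ 5, -1 + t - t ^ 4 + t ^ 5,
      1 - t] : Fin 4 → R)) ᵥ* ((burauGL t 0 ^ 2)⁻¹).val =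
        (![1 - t + t ^ 3 - t ^ 4 - t ^ 5 + t ^ 6, t ^ 2 - t ^ 3 + t ^ 5 - t ^ 7,
          -t ^ 2 + t ^ 3 - t ^ 6 + t ^ 7, t ^ 2 - t ^ 3] : Fin 4 → R) := by
    apply GL.vecMul_inv_eq
    simp only [pow_two (burauGL t _), Units.val_mul, ← vecMul_vecMul, vecMul_burauGL_zero]
    ext i; fin_cases i <;> simp <;> ring
  have h'' : (![t - t ^ 2, -t + t ^ 3, t - t ^ 4, 1 - t] : Fin 4 → R) ᵥ*
      (burauGL t 2 * burauGL t 1).val =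
        (![t - t ^ 2, 1 - t + t ^ 3 - t ^ 5, -1 + t - t ^ 4 + t ^ 5, 1 - t] : Fin 4 → R) := by
    simp only [Units.val_mul, ← vecMul_vecMul, vecMul_burauGL_one, vecMul_burauGL_two]
    ext i; fin_cases i <;> simp <;> ring
  apply (t.isUnit.pow 2).smul_left_cancel.mp
  rw [bigelowRight, Units.val_mul, Units.val_mul, Units.val_mul, ← vecMul_vecMul,
    ← vecMul_vecMul, ← vecMul_vecMul, h, h'', ← smul_vecMul, ← smul_vecMul, h']
  simp only [smul_cons, smul_eq_mul, smul_empty, pow_succ (burauGL t _), pow_zero, one_mul,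
    Units.val_mul, ← vecMul_vecMul, vecMul_burauGL_zero, vecMul_burauGL_one,
    vecMul_burauGL_three]
  ext i; fin_cases i <;> simp <;> ring

theorem commute_burauGL_bigelowConj : Commute (burauGL t 3) (bigelowConj (burauGL t)) := by
  refine GL.commute_conj_of_rank_one (burauGL_three_val t) (lastStrandLoop_burauGL_val t) ?_ ?_
  · apply (t.isUnit.pow 3).mul_left_cancel
    rw [Units.val_mul, ← mulVec_mulVec, dotProduct_mulVec, vecMul_bigelowRight_burauGL,
      ← smul_eq_mul, ← dotProduct_smul, bigelowLeft_inv_burauGL_mulVec]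
    simp only [dotProduct, Fin.sum_univ_four, cons_val]
    ring
  · apply (t.isUnit.mul (t.isUnit.pow 5)).mul_left_cancel
    rw [_root_.mul_inv_rev, inv_inv, Units.val_mul, ← mulVec_mulVec, dotProduct_mulVec, mul_assoc,
      ← smul_eq_mul, ← smul_eq_mul, ← dotProduct_smul, ← smul_dotProduct,
      bigelowRight_inv_burauGL_mulVec, vecMul_bigelowLeft_burauGL]
    simp only [dotProduct, Fin.sum_univ_four, cons_val]
    ring

end Burau

open scoped commutatorElement in
/-- (Bigelow) The reduced Burau representation of `B₅` is a well-defined group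
homomorphism `ρ̄ : B₅ → GL₄(ℤ[t,t⁻¹])` (the generator matrices are invertible and
satisfy the braid relations), and it is not injective: some `w ≠ 1` maps to the identity. -/
theorem burau_B5_not_faithful :
    ∃ ρ : BraidGroup 5 →* GL (Fin 4) (LaurentPolynomial ℤ),
      (∀ i : Fin 4, (ρ (PresentedGroup.of i)).val = burauMat 5 i) ∧
      ∃ w : BraidGroup 5, w ≠ 1 ∧ ρ w = 1 := by
  have hT : (LaurentPolynomial.T 1 : LaurentPolynomial ℤ) * LaurentPolynomial.T (-1) = 1 := by
    rw [← LaurentPolynomial.T_add]; simp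
  obtain ⟨ρ, hρ⟩ := exists_burau_hom (Units.mkOfMulEqOne _ _ hT)
  obtain ⟨φ, hφ⟩ := exists_hurwitz_hom (DihedralGroup 3)
  let s : Fin 4 → BraidGroup 5 := fun i => PresentedGroup.of i
  refine ⟨ρ, fun i => ?_, ⁅s 3, bigelowConj s⁆, fun h => ?_, ?_⟩
  · rw [hρ]
    ext j k
    fin_cases i <;> fin_cases j <;> fin_cases k <;> simp [burauGL, burauMat]
  · apply not_commute_hurwitz_bigelowConj
    have := (commutatorElement_eq_one_iff_commute.mp h).map φ
    rwa [map_bigelowConj, funext hφ, hφ] at this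
  · rw [map_commutatorElement, commutatorElement_eq_one_iff_commute, map_bigelowConj, funext hρ,
      hρ]
    exact commute_burauGL_bigelowConj _
end

section
/- The reduced Burau representation of the braid group B_3 is faithful: the group homomorphism ρ̄ : B_3 → GL_2(ℤ[t, t⁻¹]) determined by σ_1 ↦ [[−t, 0], [−1, 1]] and σ_2 ↦ [[1, −t], [0, −t]] is well defined and injective. -/
section NormalForm

variable {G : Type*} [Group G]

/-- The submonoid generated by `x` and `y⁻¹`, described by left multiplication. -/
inductive IsAlternatingWord (x y : G) : G → Prop
  | one : IsAlternatingWord x y 1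
  | mul_left {w : G} : IsAlternatingWord x y w → IsAlternatingWord x y (x * w)
  | inv_mul_left {w : G} : IsAlternatingWord x y w → IsAlternatingWord x y (y⁻¹ * w)

/-- The normal form `c ^ k * p * w * q`, where `c = (x * y) ^ 3`, `p` is `1` or `x * y * x`,
`w` is a product of factors `x` and `y⁻¹`, and `q` is `1`, `x * y` or `(x * y)⁻¹`. -/
def HasBraidNormalForm (x y g : G) : Prop :=
  ∃ (k : ℤ) (p w q : G), (p = 1 ∨ p = x * y * x) ∧ IsAlternatingWord x y w ∧
    (q = 1 ∨ q = x * y ∨ q = (x * y)⁻¹) ∧ g = ((x * y) ^ 3) ^ k * (p * w * q)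

variable {x y : G}

theorem braid_garside_sq (h : x * y * x = y * x * y) :
    (x * y * x) * (x * y * x) = (x * y) ^ 3 := by
  nth_rewrite 2 [h]
  simp only [pow_succ, pow_zero, one_mul, mul_assoc]

theorem braid_garside_mul_left (h : x * y * x = y * x * y) :
    (x * y * x) * x = y * (x * y * x) := by
  rw [h]; simp only [mul_assoc] at h ⊢; rw [h]

theorem braid_garside_mul_right (h : x * y * x = y * x * y) :
    (x * y * x) * y = x * (x * y * x) := by
  rw [mul_assoc, mul_assoc, ← mul_assoc y, ← h]

theorem braid_center_commute_left (h : x * y * x = y * x * y) : Commute ((x * y) ^ 3) x := by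
  rw [← braid_garside_sq h, Commute, SemiconjBy, mul_assoc, braid_garside_mul_left h,
    ← mul_assoc, braid_garside_mul_right h, mul_assoc]

theorem braid_center_commute_right (h : x * y * x = y * x * y) : Commute ((x * y) ^ 3) y := by
  rw [← braid_garside_sq h, Commute, SemiconjBy, mul_assoc, braid_garside_mul_right h,
    ← mul_assoc, braid_garside_mul_left h, mul_assoc]

theorem HasBraidNormalForm.center_zpow_mul {g : G} (hg : HasBraidNormalForm x y g) (n : ℤ) :
    HasBraidNormalForm x y (((x * y) ^ 3) ^ n * g) := by
  obtain ⟨k, p, w, q, hp, hw, hq, rfl⟩ := hg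
  exact ⟨n + k, p, w, q, hp, hw, hq, by simp only [zpow_add, mul_assoc]⟩

theorem HasBraidNormalForm.garside_mul (h : x * y * x = y * x * y) {g : G}
    (hg : HasBraidNormalForm x y g) : HasBraidNormalForm x y (x * y * x * g) := by
  obtain ⟨k, p, w, q, hp, hw, hq, rfl⟩ := hg
  have hx := braid_center_commute_left h
  have hy := braid_center_commute_right h
  have hc := ((hx.mul_right hy).mul_right hx).zpow_left k
  rw [← mul_assoc, ← hc.eq, mul_assoc]
  apply center_zpow_mul
  rcases hp with rfl | rfl
  · exact ⟨0, _, w, q, .inr rfl, hw, hq, by simp [mul_assoc]⟩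
  · refine ⟨1, 1, w, q, .inl rfl, hw, hq, ?_⟩
    rw [← braid_garside_sq h]
    simp [mul_assoc]

theorem HasBraidNormalForm.mul_mul (h : x * y * x = y * x * y) {g : G}
    (hg : HasBraidNormalForm x y g) : HasBraidNormalForm x y (x * y * g) := by
  obtain ⟨k, p, w, q, hp, hw, hq, rfl⟩ := hg
  have hx := braid_center_commute_left h
  have hy := braid_center_commute_right h
  have hc := (hx.mul_right hy).zpow_left k
  rw [← mul_assoc, ← hc.eq, mul_assoc]
  apply center_zpow_mul
  rcases hp with rfl | rfl
  · cases hw with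
    | one =>
      rcases hq with rfl | rfl | rfl
      · exact ⟨0, 1, 1, x * y, .inl rfl, .one, .inr (.inl rfl), by simp⟩
      · exact ⟨1, 1, 1, (x * y)⁻¹, .inl rfl, .one, .inr (.inr rfl), by
          rw [zpow_one, pow_succ]; simp [pow_two, mul_assoc]⟩
      · exact ⟨0, 1, 1, 1, .inl rfl, .one, .inl rfl, by simp⟩
    | @mul_left w hw => exact ⟨0, _, w, q, .inr rfl, hw, hq, by simp [mul_assoc]⟩
    | @inv_mul_left w hw =>
      exact ⟨0, 1, _, q, .inl rfl, .mul_left hw, hq, by simp [mul_assoc]⟩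
  · refine ⟨1, 1, _, q, .inl rfl, .inv_mul_left hw, hq, ?_⟩
    have key : x * y * (x * y * x) = (x * y) ^ 3 * y⁻¹ := by
      simp [pow_succ, mul_assoc]
    rw [zpow_one, one_mul, ← mul_assoc, ← mul_assoc, key]
    simp only [mul_assoc]

theorem hasBraidNormalForm_of_mem_closure (h : x * y * x = y * x * y) {g : G}
    (hg : g ∈ Subgroup.closure {x, y}) : HasBraidNormalForm x y g := by
  have hsq := braid_garside_sq h
  have hx (g : G) : x * g = ((x * y) ^ 3) ^ (-1 : ℤ) * (x * y * (x * y * (x * y * x * g))) := by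
    simp [pow_succ, mul_assoc]
  have hx' (g : G) : x⁻¹ * g = ((x * y) ^ 3) ^ (-1 : ℤ) * (x * y * x * (x * y * g)) := by
    rw [← hsq]; simp [mul_assoc]
  have hy (g : G) : y * g =
      ((x * y) ^ 3) ^ (-1 : ℤ) * (x * y * x * (x * y * (x * y * g))) := by
    rw [← hsq]; simp [mul_assoc]
  have hy' (g : G) : y⁻¹ * g = ((x * y) ^ 3) ^ (-1 : ℤ) * (x * y * (x * y * x * g)) := by
    simp [pow_succ, mul_assoc]
  induction hg using Subgroup.closure_induction_left with
  | one => exact ⟨0, 1, 1, 1, .inl rfl, .one, .inl rfl, by simp⟩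
  | mul_left z hz g _ ih =>
    rcases hz with rfl | rfl
    · rw [hx]; exact (((ih.garside_mul h).mul_mul h).mul_mul h).center_zpow_mul _
    · rw [hy]; exact (((ih.mul_mul h).mul_mul h).garside_mul h).center_zpow_mul _
  | inv_mul_cancel z hz g _ ih =>
    rcases hz with rfl | rfl
    · rw [hx']; exact ((ih.mul_mul h).garside_mul h).center_zpow_mul _
    · rw [hy']; exact ((ih.garside_mul h).mul_mul h).center_zpow_mul _

end NormalForm

section IntegralRepresentation

variable {G : Type*} [Group G] {x y : G} {φ : G →* GL (Fin 2) ℤ}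

theorem map_inv_val_of_upper (hy : (φ y).val = !![1, 1; 0, 1]) :
    (φ y⁻¹).val = !![1, -1; 0, 1] := by
  rw [map_inv, Matrix.coe_units_inv, hy, Matrix.inv_def]
  simp [Matrix.adjugate_fin_two]

theorem IsAlternatingWord.map_entries (hx : (φ x).val = !![1, 0; -1, 1])
    (hy : (φ y).val = !![1, 1; 0, 1]) {w : G} (hw : IsAlternatingWord x y w) :
    ∃ a b c d : ℤ, (φ w).val = !![a, b; c, d] ∧ 1 ≤ a ∧ 1 ≤ d ∧ b ≤ 0 ∧ c ≤ 0 ∧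
      (w = 1 ∨ b + c < 0) := by
  induction hw with
  | one => exact ⟨1, 0, 0, 1, by simp [Matrix.one_fin_two], by simp⟩
  | @mul_left w _ ih =>
    obtain ⟨a, b, c, d, hm, ha, hd, hb, hc, -⟩ := ih
    refine ⟨a, b, c - a, d - b, ?_, by lia, by lia, by lia, by lia, .inr (by lia)⟩
    rw [map_mul, Units.val_mul, hx, hm, Matrix.mul_fin_two]
    congr! 3 <;> ring_nf
  | @inv_mul_left w _ ih =>
    obtain ⟨a, b, c, d, hm, ha, hd, hb, hc, -⟩ := ih
    refine ⟨a - c, b - d, c, d, ?_, by lia, by lia, by lia, by lia, .inr (by lia)⟩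
    rw [map_mul, Units.val_mul, map_inv_val_of_upper hy, hm, Matrix.mul_fin_two]
    congr! 3 <;> ring_nf

/-- An element of the kernel of the standard map from the braid group on three strands to
`SL₂(ℤ)` is a power of the generator `(x * y) ^ 3` of the centre. -/
theorem exists_eq_center_zpow_of_map_eq_one (h : x * y * x = y * x * y)
    (hx : (φ x).val = !![1, 0; -1, 1]) (hy : (φ y).val = !![1, 1; 0, 1]) {g : G}
    (hg : g ∈ Subgroup.closure {x, y}) (hφ : φ g = 1) :
    ∃ k : ℤ, g = ((x * y) ^ 3) ^ k := by
  obtain ⟨k, p, w, q, hp, hw, hq, rfl⟩ := hasBraidNormalForm_of_mem_closure h hg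
  refine ⟨k, ?_⟩
  obtain ⟨a, b, c, d, hm, ha, hd, hb, hc, hw1⟩ := hw.map_entries hx hy
  have hxy : (φ (x * y)).val = !![1, 1; -1, 0] := by
    rw [map_mul, Units.val_mul, hx, hy, Matrix.mul_fin_two]; simp
  have hxy' : (φ (x * y)⁻¹).val = !![0, -1; 1, 1] := by
    rw [map_inv, Matrix.coe_units_inv, hxy, Matrix.inv_def]
    simp [Matrix.adjugate_fin_two]
  have hxyx : (φ (x * y * x)).val = !![0, 1; -1, 0] := by
    rw [map_mul, Units.val_mul, hxy, hx, Matrix.mul_fin_two]; simp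
  have hcen : φ ((x * y) ^ 3) = -1 := by
    ext1
    rw [map_pow, Units.val_pow_eq_pow_val, hxy]
    decide
  have hpwq : (φ (p * w * q)).val = 1 ∨ (φ (p * w * q)).val = -1 := by
    rw [map_mul, map_zpow, hcen] at hφ
    rcases Int.even_or_odd k with hk | hk
    · left; rw [hk.neg_one_zpow, one_mul] at hφ; rw [hφ]; rfl
    · right
      rw [hk.neg_one_zpow, neg_one_mul, neg_eq_iff_eq_neg] at hφ
      rw [hφ]; rfl
  have h1 : p = 1 ∧ w = 1 ∧ q = 1 := by
    rw [map_mul, map_mul, Units.val_mul, Units.val_mul, hm] at hpwq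
    rcases hp with rfl | rfl <;> rcases hq with rfl | rfl | rfl <;>
      simp only [hxy, hxy', hxyx, map_one, Units.val_one, one_mul, mul_one, Matrix.mul_fin_two,
        Matrix.one_fin_two, ← Matrix.ext_iff, Fin.forall_fin_two, Matrix.neg_apply, Matrix.of_apply,
        Matrix.cons_val', Matrix.cons_val_zero, Matrix.cons_val_one, Matrix.cons_val_fin_one]
        at hpwq <;> lia
  obtain ⟨rfl, rfl, rfl⟩ := h1
  simp

end IntegralRepresentation

section Burau

open LaurentPolynomial

/-- The images of the two standard generators under the reduced Burau representation of `B₃`. -/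
noncomputable def burauGen (i : Fin 2) : GL (Fin 2) (LaurentPolynomial ℤ) :=
  Matrix.GeneralLinearGroup.mk'' (![!![-T 1, 0; -1, 1], !![1, -T 1; 0, -T 1]] i) <| by
    fin_cases i <;> simp [Matrix.det_fin_two, isUnit_T]

theorem burauGen_zero_val : (burauGen 0).val = !![-T 1, 0; -1, 1] := rfl

theorem burauGen_one_val : (burauGen 1).val = !![1, -T 1; 0, -T 1] := rfl

theorem burauGen_braid :
    burauGen 0 * burauGen 1 * burauGen 0 = burauGen 1 * burauGen 0 * burauGen 1 := by
  ext1
  simp only [Units.val_mul, burauGen_zero_val, burauGen_one_val, Matrix.mul_fin_two]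
  congr! 3 <;> ring_nf

/-- The reduced Burau representation of `B₃`. -/
noncomputable def burauB3 : BraidGroup 3 →* GL (Fin 2) (LaurentPolynomial ℤ) :=
  PresentedGroup.toGroup (rels := braidRels 3) (f := burauGen) <| by
    rintro r (⟨i, k, hik, -⟩ | ⟨i, k, hik, rfl⟩)
    · have := k.isLt
      lia
    · obtain rfl : i = (0 : Fin 2) := by ext; have := k.isLt; simp; lia
      obtain rfl : k = (1 : Fin 2) := by ext; simp at hik ⊢; lia
      simp only [map_mul, map_inv, FreeGroup.lift_apply_of, mul_inv_eq_one]
      exact burauGen_braid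

theorem braidGroup_three_braid :
    (PresentedGroup.of (0 : Fin 2) * PresentedGroup.of (1 : Fin 2) * PresentedGroup.of (0 : Fin 2) :
      BraidGroup 3) = PresentedGroup.of (1 : Fin 2) * PresentedGroup.of (0 : Fin 2) *
        PresentedGroup.of (1 : Fin 2) :=
  PresentedGroup.mk_eq_mk_of_mul_inv_mem (.inr ⟨(0 : Fin 2), (1 : Fin 2), rfl, rfl⟩)

theorem mem_closure_braidGroup_three (g : BraidGroup 3) :
    g ∈ Subgroup.closure
      {(PresentedGroup.of (0 : Fin 2) : BraidGroup 3), PresentedGroup.of (1 : Fin 2)} := by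
  have hr : Set.range (PresentedGroup.of : Fin 2 → BraidGroup 3) =
      {PresentedGroup.of (0 : Fin 2), PresentedGroup.of (1 : Fin 2)} := by
    ext z; simp [Fin.exists_fin_two, eq_comm]
  rw [← hr]
  exact (PresentedGroup.closure_range_of (braidRels 3)).ge (Subgroup.mem_top g)

theorem burauB3_of (i : Fin 2) : burauB3 (PresentedGroup.of i) = burauGen i :=
  PresentedGroup.toGroup.of _

theorem burauB3_injective : Function.Injective burauB3 := by
  rw [injective_iff_map_eq_one]
  intro g hg
  let ev : LaurentPolynomial ℤ →+* ℤ := eval₂ (RingHom.id ℤ) (-1)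
  have hev : ev (T 1) = -1 := by simp [ev, eval₂_T]
  let φ : BraidGroup 3 →* GL (Fin 2) ℤ := (Matrix.GeneralLinearGroup.map ev).comp burauB3
  have hφ (i : Fin 2) : (φ (PresentedGroup.of i)).val = (burauGen i).val.map ev := by
    rw [← burauB3_of]; rfl
  obtain ⟨k, rfl⟩ := exists_eq_center_zpow_of_map_eq_one (φ := φ) braidGroup_three_braid
    (by rw [hφ, burauGen_zero_val]; ext i j; fin_cases i <;> fin_cases j <;> simp [hev])
    (by rw [hφ, burauGen_one_val]; ext i j; fin_cases i <;> fin_cases j <;> simp [hev])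
    (mem_closure_braidGroup_three g) (by simp [φ, hg])
  let u : ℚˣ := Units.mk0 2 two_ne_zero
  let δ : BraidGroup 3 →* ℚˣ := (Units.map (eval₂ (Int.castRingHom ℚ) u).toMonoidHom).comp
    (Matrix.GeneralLinearGroup.det.comp burauB3)
  have hδ (i : Fin 2) : (δ (PresentedGroup.of i) : ℚ) =
      eval₂ (Int.castRingHom ℚ) u (burauGen i).val.det := by
    rw [← burauB3_of]; rfl
  have h0 : (δ (PresentedGroup.of (0 : Fin 2)) : ℚ) = -2 := by
    rw [hδ, burauGen_zero_val, Matrix.det_fin_two_of]; simp [eval₂_T, u]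
  have h1 : (δ (PresentedGroup.of (1 : Fin 2)) : ℚ) = -2 := by
    rw [hδ, burauGen_one_val, Matrix.det_fin_two_of]; simp [eval₂_T, u]
  have hk := congrArg (fun A ↦ ((Units.map (eval₂ (Int.castRingHom ℚ) u).toMonoidHom)
    (Matrix.GeneralLinearGroup.det A) : ℚ)) hg
  change ((δ _ : ℚˣ) : ℚ) = _ at hk
  rw [map_zpow, map_pow, map_mul, Units.val_zpow_eq_zpow_val, Units.val_pow_eq_pow_val,
    Units.val_mul, h0, h1] at hk
  simp only [map_one, Units.val_one] at hk
  rw [zpow_eq_one_iff_right₀ (by norm_num) (by norm_num)] at hk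
  simp [hk]

end Burau

open LaurentPolynomial in
/-- The reduced Burau representation of `B₃` is faithful: the homomorphism
`ρ̄ : B₃ → GL₂(ℤ[t,t⁻¹])` with `σ₁ ↦ [[-t, 0], [-1, 1]]` and `σ₂ ↦ [[1, -t], [0, -t]]`
is well defined and injective. -/
theorem burau_B3_faithful :
    ∃ ρ : BraidGroup 3 →* GL (Fin 2) (LaurentPolynomial ℤ),
      (ρ (PresentedGroup.of (0 : Fin 2))).val = !![-T 1, 0; -1, 1] ∧
      (ρ (PresentedGroup.of (1 : Fin 2))).val = !![1, -T 1; 0, -T 1] ∧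
      Function.Injective ρ := by
  exact ⟨burauB3, by rw [burauB3_of, burauGen_zero_val], by rw [burauB3_of, burauGen_one_val],
    burauB3_injective⟩
end
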